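/- arXiv:1704.00589 — 7 statements merged into one kernel-verified Lean document; each statement's English description precedes it below -/
import Mathlib

section
/- For every n ≥ 1 and every matrix d ∈ M_n(ℂ), every Hochschild 2-cocycle with trivial coefficients on A_s(n,d) is a 2-coboundary; that is, the second Hochschild cohomology group H²(A_s(n,d), ℂ) with trivial coefficients vanishes. -/
open scoped BigOperators

/-- The relations presenting the quantum permutation algebra `A_s(n,d)`. -/
inductive ASRel (n : ℕ) (d : Matrix (Fin n) (Fin n) ℂ) :
    FreeAlgebra ℂ (Fin n × Fin n) → FreeAlgebra ℂ (Fin n × Fin n) → Prop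
  | row_orth (i j k : Fin n) :
      ASRel n d (FreeAlgebra.ι ℂ (i, j) * FreeAlgebra.ι ℂ (i, k))
        (if j = k then FreeAlgebra.ι ℂ (i, j) else 0)
  | col_orth (i j k : Fin n) :
      ASRel n d (FreeAlgebra.ι ℂ (j, i) * FreeAlgebra.ι ℂ (k, i))
        (if j = k then FreeAlgebra.ι ℂ (j, i) else 0)
  | row_sum (i : Fin n) : ASRel n d (∑ j, FreeAlgebra.ι ℂ (i, j)) 1
  | col_sum (i : Fin n) : ASRel n d (∑ j, FreeAlgebra.ι ℂ (j, i)) 1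
  | inter (i j : Fin n) :
      ASRel n d (∑ k, d i k • FreeAlgebra.ι ℂ (k, j)) (∑ k, d k j • FreeAlgebra.ι ℂ (i, k))

/-- The quantum permutation algebra `A_s(n,d)`. -/
abbrev ASAlg (n : ℕ) (d : Matrix (Fin n) (Fin n) ℂ) := RingQuot (ASRel n d)

/-- The generators `u_{ij}` of `A_s(n,d)`. -/
noncomputable def ASu {n : ℕ} (d : Matrix (Fin n) (Fin n) ℂ) (i j : Fin n) : ASAlg n d :=
  RingQuot.mkAlgHom ℂ (ASRel n d) (FreeAlgebra.ι ℂ (i, j))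

/-- The counit `ε : A_s(n,d) → ℂ`, the unique algebra map with `ε(u_{ij}) = δ_{ij}`. -/
noncomputable def ASeps (n : ℕ) (d : Matrix (Fin n) (Fin n) ℂ) : ASAlg n d →ₐ[ℂ] ℂ :=
  RingQuot.liftAlgHom ℂ
    ⟨FreeAlgebra.lift ℂ (fun p => if p.1 = p.2 then (1 : ℂ) else 0), by
      intro a b h
      induction h with
      | row_orth i j k =>
          simp only [map_mul, FreeAlgebra.lift_ι_apply, apply_ite, map_zero]
          split_ifs <;> simp_all
      | col_orth i j k =>
          simp only [map_mul, FreeAlgebra.lift_ι_apply, apply_ite, map_zero]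
          split_ifs <;> simp_all
      | row_sum i =>
          simp [FreeAlgebra.lift_ι_apply]
      | col_sum i =>
          simp [FreeAlgebra.lift_ι_apply]
      | inter i j =>
          simp [FreeAlgebra.lift_ι_apply, smul_ite]⟩

lemma ASeps_u {n : ℕ} (d : Matrix (Fin n) (Fin n) ℂ) (i j : Fin n) :
    ASeps n d (ASu d i j) = if i = j then 1 else 0 := by
  simp [ASeps, ASu, RingQuot.liftAlgHom_mkAlgHom_apply, FreeAlgebra.lift_ι_apply]

section SquareZeroExtension

variable {R A : Type*} [CommRing R] [Ring A] [Algebra R A]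

/-- Multiplication of the extension of `A` by `R` attached to a bilinear form `c`
on the augmented algebra `(A, ε)`. -/
def extMul (ε : A →ₐ[R] R) (c : A →ₗ[R] A →ₗ[R] R) : (A × R) →ₗ[R] (A × R) →ₗ[R] (A × R) :=
  LinearMap.mk₂ R (fun p q => (p.1 * q.1, ε p.1 * q.2 + p.2 * ε q.1 + c p.1 q.1))
    (fun p p' q => by
      ext
      · simp [add_mul]
      · simp; ring)
    (fun r p q => by
      ext
      · simp
      · simp; ring)
    (fun p q q' => by
      ext
      · simp [mul_add]
      · simp; ring)
    (fun r p q => by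
      ext
      · simp
      · simp; ring)

variable {ε : A →ₐ[R] R} {c : A →ₗ[R] A →ₗ[R] R}

@[simp] lemma extMul_apply (p q : A × R) :
    extMul ε c p q = (p.1 * q.1, ε p.1 * q.2 + p.2 * ε q.1 + c p.1 q.1) := rfl

lemma extMul_mul_extMul
    (hc : ∀ a b x : A, ε a * c b x - c (a * b) x + c a (b * x) - c a b * ε x = 0)
    (p q : A × R) : extMul ε c p * extMul ε c q = extMul ε c (extMul ε c p q) := by
  refine LinearMap.ext fun r => Prod.ext ?_ ?_
  · simp [mul_assoc]
  · simp only [Module.End.mul_apply, extMul_apply, map_mul]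
    linear_combination hc p.1 q.1 r.1

lemma cocycle_one_left
    (hc : ∀ a b x : A, ε a * c b x - c (a * b) x + c a (b * x) - c a b * ε x = 0) (x : A) :
    c 1 x = c 1 1 * ε x := by
  have h := hc 1 1 x
  simp only [map_one, one_mul] at h
  linear_combination h

lemma extMul_one
    (hc : ∀ a b x : A, ε a * c b x - c (a * b) x + c a (b * x) - c a b * ε x = 0) :
    extMul ε c (1, -c 1 1) = 1 := by
  refine LinearMap.ext fun r => Prod.ext ?_ ?_
  · simp
  · simp only [extMul_apply, map_one, Module.End.one_apply]
    linear_combination cocycle_one_left hc r.1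

/-- A cocycle is a coboundary as soon as the left regular representation of the associated
extension restricts to a representation of `A`. -/
lemma exists_coboundary_of_algHom
    (hc : ∀ a b x : A, ε a * c b x - c (a * b) x + c a (b * x) - c a b * ε x = 0)
    (Φ : A →ₐ[R] Module.End R (A × R)) (hΦ : ∀ a, ∃ s : R, Φ a = extMul ε c (a, s)) :
    ∃ ψ : A →ₗ[R] R, ∀ a b : A, c a b = ε a * ψ b - ψ (a * b) + ψ a * ε b := by
  let ψ : A →ₗ[R] R :=
    c.flip 1 - LinearMap.snd R A R ∘ₗ LinearMap.applyₗ ((1, 0) : A × R) ∘ₗ Φ.toLinearMap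
  have hψ : ∀ a s, Φ a = extMul ε c (a, s) → ψ a = -s := by
    intro a s h
    change c a 1 - (Φ a (1, 0)).2 = -s
    rw [h]
    simp
  refine ⟨ψ, fun a b => ?_⟩
  obtain ⟨s, hs⟩ := hΦ a
  obtain ⟨t, ht⟩ := hΦ b
  obtain ⟨r, hr⟩ := hΦ (a * b)
  have h := congrArg (fun f : Module.End R (A × R) => (f (1, 0)).2) (map_mul Φ a b)
  rw [hψ a s hs, hψ b t ht, hψ _ r hr]
  rw [hr, hs, ht] at h
  simp only [Module.End.mul_apply, extMul_apply, mul_one, map_one, mul_zero, zero_add] at h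
  have h₁ := hc a b 1
  simp only [map_one, mul_one] at h₁
  linear_combination -h - h₁

variable (ε c) in
/-- The unique lift of an idempotent `p` of `A` to an idempotent of the extension attached
to a cocycle `c`. -/
def idemLift (p : A) : A × R := (p, (1 - 2 * ε p) * c p p)

section OrthogonalIdempotents

variable {ι : Type*} [DecidableEq ι] {p : ι → A}

lemma extMul_idemLift
    (hc : ∀ a b x : A, ε a * c b x - c (a * b) x + c a (b * x) - c a b * ε x = 0)
    (hp : ∀ i j, p i * p j = if i = j then p i else 0) (i j : ι) :
    extMul ε c (idemLift ε c (p i)) (idemLift ε c (p j)) =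
      if i = j then idemLift ε c (p i) else 0 := by
  have hidem : ∀ i, p i * p i = p i := fun i => by simp [hp]
  have hεidem : ∀ i, ε (p i) * ε (p i) = ε (p i) := fun i => by rw [← map_mul, hidem]
  split_ifs with hij
  · subst hij
    refine Prod.ext (hidem i) ?_
    simp only [extMul_apply, idemLift]
    linear_combination (-4 * c (p i) (p i)) * hεidem i
  · have hzero : p i * p j = 0 := by simp [hp, hij]
    have hεzero : ε (p i) * ε (p j) = 0 := by rw [← map_mul, hzero, map_zero]
    have h₁ := hc (p i) (p i) (p j)
    have h₂ := hc (p i) (p j) (p j)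
    simp only [hidem, hzero, map_zero, LinearMap.zero_apply] at h₁ h₂
    refine Prod.ext hzero ?_
    simp only [extMul_apply, idemLift, Prod.snd_zero]
    linear_combination -h₁ + ε (p i) * h₂ - c (p j) (p j) * hεidem i +
      (c (p i) (p j) - 2 * c (p i) (p i) - 2 * c (p j) (p j)) * hεzero

lemma sum_idemLift [Fintype ι]
    (hc : ∀ a b x : A, ε a * c b x - c (a * b) x + c a (b * x) - c a b * ε x = 0)
    (hp : ∀ i j, p i * p j = if i = j then p i else 0) (hsum : ∑ i, p i = 1) :
    ∑ i, idemLift ε c (p i) = (1, -c 1 1) := by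
  obtain ⟨t, ht⟩ : ∃ t, ∑ i, idemLift ε c (p i) = (1, t) :=
    ⟨_, Prod.ext (by simp [Prod.fst_sum, idemLift, hsum]) rfl⟩
  have h : extMul ε c (∑ i, idemLift ε c (p i)) (∑ i, idemLift ε c (p i)) =
      ∑ i, idemLift ε c (p i) := by
    simp only [map_sum, LinearMap.sum_apply, extMul_idemLift hc hp]
    simp
  rw [ht] at h ⊢
  have h₂ := congrArg Prod.snd h
  simp only [extMul_apply, map_one] at h₂
  refine Prod.ext rfl ?_
  linear_combination h₂

end OrthogonalIdempotents

end SquareZeroExtension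

lemma magic_corner_commutator {R B ι : Type*} [CommRing R] [Ring B] [Algebra R B] [Fintype ι]
    [DecidableEq ι] (d : Matrix ι ι R) (V : ι → ι → B)
    (hrow : ∀ i j k, V i j * V i k = if j = k then V i j else 0)
    (hcol : ∀ i j k, V j i * V k i = if j = k then V j i else 0) (i j : ι) :
    V i i * (∑ k, d i k • V k j - ∑ k, d k j • V i k) * V j j = 0 := by
  have h₁ : (∑ k, d i k • V k j) * V j j = d i j • V j j := by simp [Finset.sum_mul, hcol]
  have h₂ : V i i * ∑ k, d k j • V i k = d i j • V i i := by simp [Finset.mul_sum, hrow]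
  rw [mul_sub, sub_mul, mul_assoc, h₁, h₂, mul_smul_comm, smul_mul_assoc, sub_self]

section QuantumPermutation

variable {n : ℕ} (d : Matrix (Fin n) (Fin n) ℂ)

lemma ASu_row (i j k : Fin n) : ASu d i j * ASu d i k = if j = k then ASu d i j else 0 := by
  simpa [ASu, apply_ite] using RingQuot.mkAlgHom_rel ℂ (ASRel.row_orth (d := d) i j k)

lemma ASu_col (i j k : Fin n) : ASu d j i * ASu d k i = if j = k then ASu d j i else 0 := by
  simpa [ASu, apply_ite] using RingQuot.mkAlgHom_rel ℂ (ASRel.col_orth (d := d) i j k)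

lemma ASu_row_sum (i : Fin n) : ∑ j, ASu d i j = 1 := by
  simpa [ASu] using RingQuot.mkAlgHom_rel ℂ (ASRel.row_sum (d := d) i)

lemma ASu_col_sum (i : Fin n) : ∑ j, ASu d j i = 1 := by
  simpa [ASu] using RingQuot.mkAlgHom_rel ℂ (ASRel.col_sum (d := d) i)

lemma ASu_inter (i j : Fin n) : ∑ k, d i k • ASu d k j = ∑ k, d k j • ASu d i k := by
  simpa [ASu] using RingQuot.mkAlgHom_rel ℂ (ASRel.inter (d := d) i j)

variable {d} in
/-- Universal property of `A_s(n,d)`. -/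
lemma exists_ASAlg_algHom {B : Type*} [Ring B] [Algebra ℂ B] (V : Fin n → Fin n → B)
    (hrow : ∀ i j k, V i j * V i k = if j = k then V i j else 0)
    (hcol : ∀ i j k, V j i * V k i = if j = k then V j i else 0)
    (hrow_sum : ∀ i, ∑ j, V i j = 1) (hcol_sum : ∀ i, ∑ j, V j i = 1)
    (hinter : ∀ i j, ∑ k, d i k • V k j = ∑ k, d k j • V i k) :
    ∃ Φ : ASAlg n d →ₐ[ℂ] B, ∀ i j, Φ (ASu d i j) = V i j := by
  refine ⟨RingQuot.liftAlgHom ℂ ⟨FreeAlgebra.lift ℂ fun p => V p.1 p.2, ?_⟩, fun i j => ?_⟩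
  · intro a b h
    induction h with
    | row_orth i j k => rw [map_mul]; split_ifs with hjk <;> simp [hrow, hjk]
    | col_orth i j k => rw [map_mul]; split_ifs with hjk <;> simp [hcol, hjk]
    | row_sum i => simp [hrow_sum]
    | col_sum i => simp [hcol_sum]
    | inter i j => simp [hinter]
  · simp [ASu, RingQuot.liftAlgHom_mkAlgHom_apply]

lemma ASu_adjoin_eq_top :
    Algebra.adjoin ℂ (Set.range fun p : Fin n × Fin n => ASu d p.1 p.2) = ⊤ := by
  have h : (Set.range fun p : Fin n × Fin n => ASu d p.1 p.2) =
      RingQuot.mkAlgHom ℂ (ASRel n d) '' Set.range (FreeAlgebra.ι ℂ) := by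
    rw [← Set.range_comp]; rfl
  rw [h, ← AlgHom.map_adjoin, FreeAlgebra.adjoin_range_ι, Algebra.map_top,
    AlgHom.range_eq_top]
  exact RingQuot.mkAlgHom_surjective ℂ _

end QuantumPermutation

/-- For every `n ≥ 1` and every matrix `d ∈ M_n(ℂ)`, every Hochschild
2-cocycle with trivial coefficients on `A_s(n,d)` is a 2-coboundary, i.e.
`H²(A_s(n,d), ℂ) = 0`. -/
theorem second_cohomology_vanishes (n : ℕ) (hn : 1 ≤ n) (d : Matrix (Fin n) (Fin n) ℂ)
    (c : ASAlg n d →ₗ[ℂ] ASAlg n d →ₗ[ℂ] ℂ)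
    (hcocycle : ∀ a b x : ASAlg n d,
      ASeps n d a * c b x - c (a * b) x + c a (b * x) - c a b * ASeps n d x = 0) :
    ∃ ψ : ASAlg n d →ₗ[ℂ] ℂ, ∀ a b : ASAlg n d,
      c a b = ASeps n d a * ψ b - ψ (a * b) + ψ a * ASeps n d b := by
  let V : Fin n → Fin n → Module.End ℂ (ASAlg n d × ℂ) := fun i j =>
    extMul (ASeps n d) c (idemLift (ASeps n d) c (ASu d i j))
  have hrow : ∀ i j k, V i j * V i k = if j = k then V i j else 0 := fun i j k => by
    simp only [V]
    rw [extMul_mul_extMul hcocycle,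
      extMul_idemLift hcocycle (p := fun j => ASu d i j) (ASu_row d i)]
    split_ifs <;> simp
  have hcol : ∀ i j k, V j i * V k i = if j = k then V j i else 0 := fun i j k => by
    simp only [V]
    rw [extMul_mul_extMul hcocycle,
      extMul_idemLift hcocycle (p := fun j => ASu d j i) (ASu_col d i)]
    split_ifs <;> simp
  have hrow_sum : ∀ i, ∑ j, V i j = 1 := fun i => by
    simp only [V]
    rw [← map_sum, sum_idemLift hcocycle (ASu_row d i) (ASu_row_sum d i), extMul_one hcocycle]
  have hcol_sum : ∀ i, ∑ j, V j i = 1 := fun i => by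
    simp only [V]
    rw [← map_sum, sum_idemLift hcocycle (ASu_col d i) (ASu_col_sum d i), extMul_one hcocycle]
  have hinter : ∀ i j, ∑ k, d i k • V k j = ∑ k, d k j • V i k := fun i j => by
    obtain ⟨w, hw⟩ : ∃ w : ℂ, ∑ k, d i k • V k j - ∑ k, d k j • V i k =
        extMul (ASeps n d) c (0, w) := by
      refine ⟨(∑ k, d i k • idemLift (ASeps n d) c (ASu d k j) -
        ∑ k, d k j • idemLift (ASeps n d) c (ASu d i k)).2, ?_⟩
      simp only [V, ← map_smul, ← map_sum]
      refine (map_sub (extMul (ASeps n d) c) _ _).symm.trans (congrArg _ (Prod.ext ?_ rfl))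
      simp [Prod.fst_sum, idemLift, ASu_inter]
    have h := magic_corner_commutator d V hrow hcol i j
    rw [hw, extMul_mul_extMul hcocycle, extMul_mul_extMul hcocycle] at h
    rw [← sub_eq_zero, hw, ← h]
    congr 1
    simp [idemLift, ASeps_u]
  obtain ⟨Φ, hΦ⟩ := exists_ASAlg_algHom V hrow hcol hrow_sum hcol_sum hinter
  refine exists_coboundary_of_algHom hcocycle Φ fun a => ?_
  have ha : a ∈ Algebra.adjoin ℂ (Set.range fun p : Fin n × Fin n => ASu d p.1 p.2) := by
    rw [ASu_adjoin_eq_top]; trivial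
  induction ha using Algebra.adjoin_induction with
  | mem x hx =>
    obtain ⟨p, rfl⟩ := hx
    exact ⟨_, hΦ p.1 p.2⟩
  | algebraMap r =>
    refine ⟨r • -c 1 1, ?_⟩
    rw [AlgHom.commutes, Algebra.algebraMap_eq_smul_one, Algebra.algebraMap_eq_smul_one,
      ← Prod.smul_mk, map_smul, extMul_one hcocycle]
  | add x y _ _ hx hy =>
    obtain ⟨s, hs⟩ := hx
    obtain ⟨t, ht⟩ := hy
    exact ⟨s + t, by rw [map_add, hs, ht, ← map_add, Prod.mk_add_mk]⟩
  | mul x y _ _ hx hy =>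
    obtain ⟨s, hs⟩ := hx
    obtain ⟨t, ht⟩ := hy
    exact ⟨_, by rw [map_mul, hs, ht, extMul_mul_extMul hcocycle]; rfl⟩
end

section
/- For every n ≥ 1 and every matrix d ∈ M_n(ℂ), every ℂ-linear map η : A_s(n,d) → ℂ satisfying η(ab) = ε(a)η(b) + η(a)ε(b) for all a, b ∈ A_s(n,d) is identically zero; that is, the first Hochschild cohomology group H¹(A_s(n,d), ℂ) with trivial coefficients vanishes. -/
open scoped BigOperators

lemma ASu_mul_self {n : ℕ} (d : Matrix (Fin n) (Fin n) ℂ) (i j : Fin n) :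
    ASu d i j * ASu d i j = ASu d i j := by
  have h := RingQuot.mkAlgHom_rel ℂ (ASRel.row_orth (d := d) i j j)
  simpa [ASu] using h

/-- Every ℂ-linear map `η : A_s(n,d) → ℂ` satisfying
`η(ab) = ε(a)η(b) + η(a)ε(b)` is identically zero, i.e. `H¹(A_s(n,d), ℂ) = 0`. -/
theorem first_cohomology_vanishes (n : ℕ) (hn : 1 ≤ n) (d : Matrix (Fin n) (Fin n) ℂ)
    (η : ASAlg n d →ₗ[ℂ] ℂ)
    (hη : ∀ a b : ASAlg n d, η (a * b) = ASeps n d a * η b + η a * ASeps n d b) :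
    η = 0 := by
  have h_one : η 1 = 0 := by simpa using hη 1 1
  have h_gen (i j : Fin n) : η (ASu d i j) = 0 := by
    have h := hη (ASu d i j) (ASu d i j)
    rw [ASu_mul_self, ASeps_u] at h
    split_ifs at h <;> simpa using h
  ext a
  obtain ⟨x, rfl⟩ := RingQuot.mkAlgHom_surjective ℂ (ASRel n d) a
  induction x using FreeAlgebra.induction with
  | grade0 r => simp [Algebra.algebraMap_eq_smul_one, h_one]
  | grade1 p => exact h_gen p.1 p.2
  | mul x y hx hy => simp_all
  | add x y hx hy => simp_all
end

section
/- Let (A, ε) be an augmented ℂ-algebra, A⁺ = ker ε, let ψ : A → ℂ be a ℂ-linear map with ψ(1) = 0, and let c be a normalized Hochschild 2-cocycle with trivial coefficients on A. For a ∈ A define the linear endomorphism ρ(a) of ℂ × A⁺ × ℂ by ρ(a)(α, v, β) = (ε(a)α + c(a, v) + ψ(a)β, a·v + β(a − ε(a)1), ε(a)β) (note that a·v ∈ A⁺ and a − ε(a)1 ∈ A⁺, so this is well defined). Then ρ : A → End(ℂ × A⁺ × ℂ) is a unital algebra homomorphism if and only if c(a,b) = −ε(a)ψ(b) + ψ(ab)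 − ψ(a)ε(b) for all a, b ∈ A, i.e., if and only if c = δ(−ψ). -/
/-- For an augmented algebra `(A, ε)`, the element `a·v + β(a − ε(a)1)` lies in the
augmentation ideal `A⁺ = ker ε` whenever `v` does. -/
lemma aug_mem_aux {A : Type*} [Ring A] [Algebra ℂ A] (ε : A →ₐ[ℂ] ℂ) (a v : A)
    (hv : v ∈ LinearMap.ker ε.toLinearMap) (β : ℂ) :
    a * v + β • (a - algebraMap ℂ A (ε a)) ∈ LinearMap.ker ε.toLinearMap := by
  simp only [LinearMap.mem_ker, AlgHom.toLinearMap_apply] at hv ⊢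
  simp [hv]

/-- A normalized Hochschild 2-cocycle with trivial coefficients vanishes when its first
argument is `1`. -/
lemma hochschild_cocycle_one_left {A : Type*} [Ring A] [Algebra ℂ A] (ε : A →ₐ[ℂ] ℂ)
    (c : A →ₗ[ℂ] A →ₗ[ℂ] ℂ)
    (hcocycle : ∀ a b x : A, ε a * c b x - c (a * b) x + c a (b * x) - c a b * ε x = 0)
    (hnorm : c 1 1 = 0) (x : A) : c 1 x = 0 := by
  simpa [hnorm] using hcocycle 1 1 x

/-- A normalized Hochschild 2-cocycle with trivial coefficients vanishes when its second
argument is `1`. -/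
lemma hochschild_cocycle_one_right {A : Type*} [Ring A] [Algebra ℂ A] (ε : A →ₐ[ℂ] ℂ)
    (c : A →ₗ[ℂ] A →ₗ[ℂ] ℂ)
    (hcocycle : ∀ a b x : A, ε a * c b x - c (a * b) x + c a (b * x) - c a b * ε x = 0)
    (hnorm : c 1 1 = 0) (a : A) : c a 1 = 0 := by
  simpa [hnorm] using hcocycle a 1 1

/-- The linear map `ρ : A → End(ℂ × A⁺ × ℂ)` attached to a bilinear map `c` and a
functional `ψ`. -/
noncomputable def augRho {A : Type*} [Ring A] [Algebra ℂ A] (ε : A →ₐ[ℂ] ℂ)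
    (ψ : A →ₗ[ℂ] ℂ) (c : A →ₗ[ℂ] A →ₗ[ℂ] ℂ) :
    A →ₗ[ℂ] Module.End ℂ (ℂ × ↥(LinearMap.ker ε.toLinearMap) × ℂ) :=
  LinearMap.mk₂ ℂ
    (fun a p => (ε a * p.1 + c a ↑p.2.1 + ψ a * p.2.2,
      ⟨a * ↑p.2.1 + p.2.2 • (a - algebraMap ℂ A (ε a)), aug_mem_aux ε a ↑p.2.1 p.2.1.2 p.2.2⟩,
      ε a * p.2.2))
    (fun a b p => by
      ext
      · simp; ring
      · simp [add_mul, smul_add, smul_sub]; abel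
      · simp [add_mul])
    (fun r a p => by
      ext
      · simp; ring
      · simp [smul_add, smul_sub, Algebra.algebraMap_eq_smul_one, smul_smul, mul_comm,
          mul_left_comm]
      · simp [mul_assoc])
    (fun a p q => by
      ext
      · simp; ring
      · simp [mul_add, add_smul]; abel
      · simp [mul_add])
    (fun r a p => by
      ext
      · simp; ring
      · simp [smul_add, smul_smul]
      · simp [mul_left_comm])

/-- Let `(A, ε)` be an augmented ℂ-algebra, `A⁺ = ker ε`, `ψ : A → ℂ`
linear with `ψ(1) = 0`, and `c` a normalized Hochschild 2-cocycle with trivial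
coefficients. Then the map `ρ : A → End(ℂ × A⁺ × ℂ)` given by
`ρ(a)(α, v, β) = (ε(a)α + c(a,v) + ψ(a)β, a·v + β(a − ε(a)1), ε(a)β)` is a unital
algebra homomorphism if and only if `c = δ(−ψ)`. -/
theorem rho_algHom_iff_coboundary (A : Type*) [Ring A] [Algebra ℂ A] (ε : A →ₐ[ℂ] ℂ)
    (ψ : A →ₗ[ℂ] ℂ) (hψ : ψ 1 = 0)
    (c : A →ₗ[ℂ] A →ₗ[ℂ] ℂ)
    (hcocycle : ∀ a b x : A, ε a * c b x - c (a * b) x + c a (b * x) - c a b * ε x = 0)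
    (hnorm : c 1 1 = 0) :
    (∃ ρ : A →ₐ[ℂ] Module.End ℂ (ℂ × ↥(LinearMap.ker ε.toLinearMap) × ℂ),
        ∀ (a : A) (α : ℂ) (v : ↥(LinearMap.ker ε.toLinearMap)) (β : ℂ),
          ρ a (α, v, β) =
            (ε a * α + c a ↑v + ψ a * β,
             ⟨a * ↑v + β • (a - algebraMap ℂ A (ε a)), aug_mem_aux ε a ↑v v.2 β⟩,
             ε a * β)) ↔
      ∀ a b : A, c a b = -(ε a * ψ b) + ψ (a * b) - ψ a * ε b := by
  have hl := hochschild_cocycle_one_left ε c hcocycle hnorm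
  have hr := hochschild_cocycle_one_right ε c hcocycle hnorm
  constructor
  · rintro ⟨ρ, hρ⟩ a b
    have h := congrArg Prod.fst (LinearMap.congr_fun (map_mul ρ a b) (0, 0, 1))
    rw [Module.End.mul_apply, hρ, hρ, hρ] at h
    simp [Algebra.algebraMap_eq_smul_one, hr] at h
    linear_combination -h
  · intro h
    refine ⟨AlgHom.ofLinearMap (augRho ε ψ c) ?_ ?_, fun a α v β => rfl⟩
    · refine LinearMap.ext fun p => ?_
      ext
      · simp [augRho, hl, hψ]
      · simp [augRho]
      · simp [augRho]
    · intro a b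
      refine LinearMap.ext fun p => ?_
      ext
      · have hv : ε (p.2.1 : A) = 0 := p.2.1.2
        have hc := hcocycle a b p.2.1
        have hab := h a b
        simp [augRho, Algebra.algebraMap_eq_smul_one, hr]
        linear_combination -hc - c a b * hv - p.2.2 * hab
      · simp [augRho, Algebra.algebraMap_eq_smul_one, mul_add, mul_sub, smul_sub, smul_smul,
          mul_assoc, mul_comm, mul_left_comm]
        abel
      · simp [augRho, mul_assoc]
end

section
/- Let c be a normalized Hochschild 2-cocycle with trivial coefficients on A_s(n,d). Then for all indices i, j, k with i ≠ j, k ≠ i and k ≠ j, one has c(u_{ij}, u_{ik}) = 0 = c(u_{ji}, u_{ki}). -/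
open scoped BigOperators

lemma ASu_row_mul {n : ℕ} (d : Matrix (Fin n) (Fin n) ℂ) (i j k : Fin n) :
    ASu d i j * ASu d i k = if j = k then ASu d i j else 0 := by
  have h := RingQuot.mkAlgHom_rel ℂ (ASRel.row_orth (d := d) i j k)
  rwa [map_mul, apply_ite (RingQuot.mkAlgHom ℂ (ASRel n d)), map_zero] at h

lemma ASu_col_mul {n : ℕ} (d : Matrix (Fin n) (Fin n) ℂ) (i j k : Fin n) :
    ASu d j i * ASu d k i = if j = k then ASu d j i else 0 := by
  have h := RingQuot.mkAlgHom_rel ℂ (ASRel.col_orth (d := d) i j k)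
  rwa [map_mul, apply_ite (RingQuot.mkAlgHom ℂ (ASRel n d)), map_zero] at h

/-- A Hochschild 2-cocycle with trivial coefficients vanishes on `(p, q)` when `p` is idempotent,
`p * q = 0`, and both lie in the kernel of the augmentation. -/
lemma cocycle_apply_eq_zero_of_isIdempotentElem {R A : Type*} [CommRing R] [Ring A] [Algebra R A]
    (ε : A →ₐ[R] R) (c : A →ₗ[R] A →ₗ[R] R)
    (hc : ∀ a b x : A, ε a * c b x - c (a * b) x + c a (b * x) - c a b * ε x = 0)
    {p q : A} (hp : IsIdempotentElem p) (hpq : p * q = 0) (hεp : ε p = 0) (hεq : ε q = 0) :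
    c p q = 0 := by
  simpa [hp.eq, hpq, hεp, hεq] using hc p p q

/-- Item (3) of Lemma 5.2: for a normalized Hochschild 2-cocycle `c` with
trivial coefficients on `A_s(n,d)` and pairwise distinct relevant indices,
`c(u_{ij}, u_{ik}) = 0 = c(u_{ji}, u_{ki})`. -/
theorem cocycle_vanishing_off_diagonal (n : ℕ) (hn : 1 ≤ n) (d : Matrix (Fin n) (Fin n) ℂ)
    (c : ASAlg n d →ₗ[ℂ] ASAlg n d →ₗ[ℂ] ℂ)
    (hcocycle : ∀ a b x : ASAlg n d,
      ASeps n d a * c b x - c (a * b) x + c a (b * x) - c a b * ASeps n d x = 0)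
    (hnorm : c 1 1 = 0) :
    ∀ i j k : Fin n, i ≠ j → k ≠ i → k ≠ j →
      c (ASu d i j) (ASu d i k) = 0 ∧ c (ASu d j i) (ASu d k i) = 0 := by
  intro i j k hij hki hkj
  constructor
  · exact cocycle_apply_eq_zero_of_isIdempotentElem _ c hcocycle
      (by simp [IsIdempotentElem, ASu_row_mul]) (by simp [ASu_row_mul, hkj.symm])
      (by simp [ASeps_u, hij]) (by simp [ASeps_u, hki.symm])
  · exact cocycle_apply_eq_zero_of_isIdempotentElem _ c hcocycle
      (by simp [IsIdempotentElem, ASu_col_mul]) (by simp [ASu_col_mul, hkj.symm])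
      (by simp [ASeps_u, hij.symm]) (by simp [ASeps_u, hki])
end

section
/- Let c be a normalized Hochschild 2-cocycle with trivial coefficients on A_s(n,d). Then for all indices i, j one has c(u_{ij}, u_{ii}) = c(u_{ii}, u_{ij}) = c(u_{ij}, u_{jj}) = c(u_{jj}, u_{ij}). -/
open scoped BigOperators

lemma ASu_mul_row {n : ℕ} (d : Matrix (Fin n) (Fin n) ℂ) (i : Fin n) {j k : Fin n} (h : j ≠ k) :
    ASu d i j * ASu d i k = 0 := by
  simpa [ASu, h] using RingQuot.mkAlgHom_rel ℂ (ASRel.row_orth (d := d) i j k)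

lemma ASu_mul_col {n : ℕ} (d : Matrix (Fin n) (Fin n) ℂ) (i : Fin n) {j k : Fin n} (h : j ≠ k) :
    ASu d j i * ASu d k i = 0 := by
  simpa [ASu, h] using RingQuot.mkAlgHom_rel ℂ (ASRel.col_orth (d := d) i j k)

/-- If `a b = 0 = b x` and `ε(a) = ε(x) = 1`, the cocycle identity gives `c(a, b) = c(b, x)`. -/
lemma cocycle_eq_of_mul_eq_zero {n : ℕ} {d : Matrix (Fin n) (Fin n) ℂ}
    {c : ASAlg n d →ₗ[ℂ] ASAlg n d →ₗ[ℂ] ℂ}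
    (hcocycle : ∀ a b x : ASAlg n d,
      ASeps n d a * c b x - c (a * b) x + c a (b * x) - c a b * ASeps n d x = 0)
    {a b x : ASAlg n d} (hab : a * b = 0) (hbx : b * x = 0)
    (ha : ASeps n d a = 1) (hx : ASeps n d x = 1) : c a b = c b x := by
  have h := hcocycle a b x
  simp only [hab, hbx, ha, hx, map_zero, LinearMap.zero_apply] at h
  linear_combination -h

/-- Item (4) of Lemma 5.2: for a normalized Hochschild 2-cocycle `c` with
trivial coefficients on `A_s(n,d)`,
`c(u_{ij}, u_{ii}) = c(u_{ii}, u_{ij}) = c(u_{ij}, u_{jj}) = c(u_{jj}, u_{ij})`. -/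
theorem cocycle_diagonal_identities (n : ℕ) (hn : 1 ≤ n) (d : Matrix (Fin n) (Fin n) ℂ)
    (c : ASAlg n d →ₗ[ℂ] ASAlg n d →ₗ[ℂ] ℂ)
    (hcocycle : ∀ a b x : ASAlg n d,
      ASeps n d a * c b x - c (a * b) x + c a (b * x) - c a b * ASeps n d x = 0)
    (hnorm : c 1 1 = 0) :
    ∀ i j : Fin n,
      c (ASu d i j) (ASu d i i) = c (ASu d i i) (ASu d i j)
      ∧ c (ASu d i i) (ASu d i j) = c (ASu d i j) (ASu d j j)
      ∧ c (ASu d i j) (ASu d j j) = c (ASu d j j) (ASu d i j) := by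
  intro i j
  rcases eq_or_ne i j with rfl | hij
  · exact ⟨rfl, rfl, rfl⟩
  have hε (k : Fin n) : ASeps n d (ASu d k k) = 1 := by simp [ASeps_u]
  have hi := ASu_mul_row d i hij
  have hi' := ASu_mul_row d i hij.symm
  have hj := ASu_mul_col d j hij
  have hj' := ASu_mul_col d j hij.symm
  exact ⟨(cocycle_eq_of_mul_eq_zero hcocycle hi hi' (hε i) (hε i)).symm,
    cocycle_eq_of_mul_eq_zero hcocycle hi hj (hε i) (hε j),
    (cocycle_eq_of_mul_eq_zero hcocycle hj' hj (hε j) (hε j)).symm⟩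
end

section
/- For every n ≥ 1, the ℂ-linear span of the set {ab − ε(a)b − ε(b)a : a, b ∈ A_s(n)} is all of A_s(n). (Consequently Tor₁^{A_s(n)}(ℂ_ε, ℂ_ε) = 0, which is the key computation giving H²(A_s(n), ℂ) = 0 via the Calabi-Yau duality.) -/
open scoped BigOperators

/-- For `A_s(n)` (realized as `A_s(n,d)` with `d = 0`, since the extra
relation for `d = 0` is the trivial relation `0 = 0`), the linear span of the elements
`ab − ε(a)b − ε(b)a` is all of `A_s(n)`; consequently `Tor₁(ℂ_ε, ℂ_ε) = 0`, which is the
key step giving `H²(A_s(n), ℂ) = 0`. -/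
theorem span_eq_top (n : ℕ) (hn : 1 ≤ n) :
    Submodule.span ℂ {x : ASAlg n 0 | ∃ a b : ASAlg n 0,
        x = a * b - ASeps n 0 a • b - ASeps n 0 b • a} = ⊤ := by
  set M := Submodule.span ℂ {x : ASAlg n 0 | ∃ a b : ASAlg n 0,
    x = a * b - ASeps n 0 a • b - ASeps n 0 b • a}
  have mem (a b : ASAlg n 0) : a * b - ASeps n 0 a • b - ASeps n 0 b • a ∈ M :=
    Submodule.subset_span ⟨a, b, rfl⟩
  have one_mem : (1 : ASAlg n 0) ∈ M := by
    simpa using mem 1 1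
  have gen_mem (i j : Fin n) : ASu 0 i j ∈ M := by
    have h := mem (ASu 0 i j) (ASu 0 i j)
    rw [ASu_mul_self, ASeps_u] at h
    split_ifs at h <;> simpa using h
  rw [eq_top_iff]
  rintro x -
  obtain ⟨y, rfl⟩ := RingQuot.mkAlgHom_surjective ℂ (ASRel n 0) x
  induction y using FreeAlgebra.induction with
  | grade0 c =>
    rw [AlgHom.commutes, Algebra.algebraMap_eq_smul_one]
    exact M.smul_mem c one_mem
  | grade1 p => exact gen_mem p.1 p.2
  | mul a b ha hb =>
    rw [map_mul]
    exact (M.sub_mem_iff_left (M.smul_mem _ hb)).mp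
      ((M.sub_mem_iff_left (M.smul_mem _ ha)).mp (mem _ _))
  | add a b ha hb =>
    rw [map_add]
    exact M.add_mem ha hb
end

section
/- For every n ≥ 4, the third Hochschild cohomology group of A_s(n) with trivial coefficients is one-dimensional: the quotient of the space of trilinear maps f : A_s(n)³ → ℂ with δ(f) = 0 by the subspace {δ(g) : g a bilinear map A_s(n)² → ℂ} is a ℂ-vector space of dimension 1, i.e., H³(A_s(n), ℂ) ≅ ℂ. -/
open scoped BigOperators

/-- The Hochschild differential with trivial coefficients for an augmented ℂ-algebra
`(A, ε)`: it sends a `p`-cochain `f : A^p → ℂ` to the `(p+1)`-cochain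
`δ(f)(a₁,…,a_{p+1}) = ε(a₁)f(a₂,…,a_{p+1}) + Σ_{i=1}^p (−1)^i f(a₁,…,a_i a_{i+1},…,a_{p+1})
  + (−1)^{p+1} f(a₁,…,a_p)ε(a_{p+1})`. -/
noncomputable def hdiff {A : Type*} [Ring A] [Algebra ℂ A] (ε : A →ₐ[ℂ] ℂ) (p : ℕ)
    (f : (Fin p → A) → ℂ) : (Fin (p + 1) → A) → ℂ := fun a =>
  ε (a 0) * f (fun j => a j.succ)
    + ∑ k : Fin p, (-1 : ℂ) ^ (k.val + 1) *
        f (fun j => if j.val < k.val then a j.castSucc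
            else if j.val = k.val then a j.castSucc * a j.succ else a j.succ)
    + (-1 : ℂ) ^ (p + 1) * f (fun j => a j.castSucc) * ε (a (Fin.last p))

set_option linter.unusedSectionVars false

namespace NCWord

variable {α : Type*} [Fintype α] [DecidableEq α]

section Operators

variable {E : Type*} [AddCommMonoid E]

/-- `cup (2 * q)` inserts an arbitrary letter at place `q`; `cup (2 * q + 1)` doubles the letter
at place `q`. Both act on functions of words. -/
def cup : ℕ → (List α → E) → List α → E
  | 0, _, [] => 0
  | 0, v, _ :: w => v w
  | 1, _, [] => 0
  | 1, _, [_] => 0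
  | 1, v, i :: j :: w => if i = j then v (j :: w) else 0
  | _ + 2, _, [] => 0
  | p + 2, v, i :: w => cup p (fun w' => v (i :: w')) w

/-- `cap (2 * q)` sums over the letter at place `q`; `cap (2 * q + 1)` evaluates at words with
equal letters at places `q` and `q + 1`. These are the transposes of `cup`. -/
def cap : ℕ → (List α → E) → List α → E
  | 0, v, w => ∑ i, v (i :: w)
  | 1, _, [] => 0
  | 1, v, i :: w => v (i :: i :: w)
  | _ + 2, _, [] => 0
  | p + 2, v, i :: w => cap p (fun w' => v (i :: w')) w

@[simp] lemma cup_nil (p : ℕ) (v : List α → E) : cup p v [] = 0 := by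
  rcases p with _ | _ | p <;> rfl

@[simp] lemma cup_zero_cons (v : List α → E) (i : α) (w : List α) : cup 0 v (i :: w) = v w := rfl

@[simp] lemma cup_one_singleton (v : List α → E) (i : α) : cup 1 v [i] = 0 := rfl

@[simp] lemma cup_one_cons_cons (v : List α → E) (i j : α) (w : List α) :
    cup 1 v (i :: j :: w) = if i = j then v (j :: w) else 0 := rfl

@[simp] lemma cup_add_two_cons (p : ℕ) (v : List α → E) (i : α) (w : List α) :
    cup (p + 2) v (i :: w) = cup p (fun w' => v (i :: w')) w := by
  rw [cup]

lemma cap_zero (v : List α → E) (w : List α) : cap 0 v w = ∑ i, v (i :: w) := by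
  rw [cap]

@[simp] lemma cap_one_nil (v : List α → E) : cap 1 v [] = 0 := rfl

@[simp] lemma cap_one_cons (v : List α → E) (i : α) (w : List α) :
    cap 1 v (i :: w) = v (i :: i :: w) := rfl

@[simp] lemma cap_add_two_nil (p : ℕ) (v : List α → E) : cap (p + 2) v [] = 0 := by
  rw [cap]

@[simp] lemma cap_add_two_cons (p : ℕ) (v : List α → E) (i : α) (w : List α) :
    cap (p + 2) v (i :: w) = cap p (fun w' => v (i :: w')) w := by
  rw [cap]

lemma map_cup {F : Type*} [AddCommMonoid F] (f : E →+ F) (p : ℕ) (v : List α → E) (w : List α) :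
    f (cup p v w) = cup p (fun w' => f (v w')) w := by
  induction p using Nat.twoStepInduction generalizing v w with
  | zero => cases w <;> simp
  | one => rcases w with _ | ⟨i, _ | ⟨j, w⟩⟩ <;> simp [apply_ite f]
  | more p ih _ => cases w <;> simp [ih]

lemma map_cap {F : Type*} [AddCommMonoid F] (f : E →+ F) (p : ℕ) (v : List α → E) (w : List α) :
    f (cap p v w) = cap p (fun w' => f (v w')) w := by
  induction p using Nat.twoStepInduction generalizing v w with
  | zero => simp [cap_zero]
  | one => cases w <;> simp
  | more p ih _ => cases w <;> simp [ih]

lemma cup_mem (N : AddSubmonoid E) (p : ℕ) (v : List α → E) (w : List α)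
    (h : ∀ c, c.length + 1 = w.length → v c ∈ N) : cup p v w ∈ N := by
  induction p using Nat.twoStepInduction generalizing v w with
  | zero => cases w with
    | nil => simp
    | cons i w => exact h w rfl
  | one =>
    rcases w with _ | ⟨i, _ | ⟨j, w⟩⟩
    · simp
    · simp
    · rw [cup_one_cons_cons]
      split_ifs
      · exact h _ rfl
      · exact N.zero_mem
  | more p ih _ => cases w with
    | nil => simp
    | cons i w => exact (cup_add_two_cons p v i w).symm ▸ ih _ _ fun c hc => h _ (by simp [hc])

lemma cap_mem (N : AddSubmonoid E) (p : ℕ) (v : List α → E) (w : List α)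
    (h : ∀ c, c.length = w.length + 1 → v c ∈ N) : cap p v w ∈ N := by
  induction p using Nat.twoStepInduction generalizing v w with
  | zero => exact (cap_zero v w).symm ▸ N.sum_mem fun i _ => h _ rfl
  | one => cases w with
    | nil => simp
    | cons i w => exact h _ rfl
  | more p ih _ => cases w with
    | nil => simp
    | cons i w => exact (cap_add_two_cons p v i w).symm ▸ ih _ _ fun c hc => h _ (by simp [hc])

lemma cup_zero_fun (p : ℕ) : cup p (0 : List α → E) = 0 := by
  ext w; exact (AddSubmonoid.mem_bot).1 (cup_mem ⊥ p 0 w fun c _ => by simp)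

lemma cap_eq_zero (p : ℕ) (v : List α → E) (w : List α)
    (h : ∀ c, c.length = w.length + 1 → v c = 0) : cap p v w = 0 :=
  (AddSubmonoid.mem_bot).1 (cap_mem ⊥ p v w fun c hc => by simp [h c hc])

lemma cup_eq_zero (p : ℕ) (v : List α → E) (w : List α)
    (h : ∀ c, c.length + 1 = w.length → v c = 0) : cup p v w = 0 :=
  (AddSubmonoid.mem_bot).1 (cup_mem ⊥ p v w fun c hc => by simp [h c hc])

lemma cup_add (p : ℕ) (v v' : List α → E) : cup p (v + v') = cup p v + cup p v' := by
  ext w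
  have h1 := map_cup (AddMonoidHom.fst E E) p (fun w => (v w, v' w)) w
  have h2 := map_cup (AddMonoidHom.snd E E) p (fun w => (v w, v' w)) w
  have h3 := map_cup (AddMonoidHom.fst E E + AddMonoidHom.snd E E) p (fun w => (v w, v' w)) w
  simp only [AddMonoidHom.coe_fst, AddMonoidHom.coe_snd, AddMonoidHom.add_apply] at h1 h2 h3
  rw [h1, h2] at h3
  exact h3.symm

lemma cap_add (p : ℕ) (v v' : List α → E) : cap p (v + v') = cap p v + cap p v' := by
  ext w
  have h1 := map_cap (AddMonoidHom.fst E E) p (fun w => (v w, v' w)) w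
  have h2 := map_cap (AddMonoidHom.snd E E) p (fun w => (v w, v' w)) w
  have h3 := map_cap (AddMonoidHom.fst E E + AddMonoidHom.snd E E) p (fun w => (v w, v' w)) w
  simp only [AddMonoidHom.coe_fst, AddMonoidHom.coe_snd, AddMonoidHom.add_apply] at h1 h2 h3
  rw [h1, h2] at h3
  exact h3.symm

variable [Module ℂ E]

lemma cup_smul (p : ℕ) (c : ℂ) (v : List α → E) : cup p (c • v) = c • cup p v := by
  ext w; exact (map_cup (DistribSMul.toAddMonoidHom E c) p v w).symm

lemma cap_smul (p : ℕ) (c : ℂ) (v : List α → E) : cap p (c • v) = c • cap p v := by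
  ext w; exact (map_cap (DistribSMul.toAddMonoidHom E c) p v w).symm

variable (α E) in
/-- `cup p` as a linear map. -/
def cupₗ (p : ℕ) : (List α → E) →ₗ[ℂ] (List α → E) where
  toFun := cup p
  map_add' := cup_add p
  map_smul' := cup_smul p

variable (α E) in
/-- `cap p` as a linear map. -/
def capₗ (p : ℕ) : (List α → E) →ₗ[ℂ] (List α → E) where
  toFun := cap p
  map_add' := cap_add p
  map_smul' := cap_smul p

@[simp] lemma capₗ_apply (p : ℕ) (v : List α → E) : capₗ α E p v = cap p v := rfl

end Operators

variable (α) in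
/-- Functions supported on the words of length `k`. -/
def homog (k : ℕ) : Submodule ℂ (List α → ℂ) where
  carrier := {v | ∀ w, w.length ≠ k → v w = 0}
  zero_mem' := fun _ _ => rfl
  add_mem' := fun hx hy w hw => by simp [hx w hw, hy w hw]
  smul_mem' := fun c x hx w hw => by simp [hx w hw]

lemma homog_cons {k : ℕ} {v : List α → ℂ} (hv : v ∈ homog α (k + 1)) (i : α) :
    (fun w => v (i :: w)) ∈ homog α k :=
  fun w hw => hv _ (by simpa using hw)

lemma cup_mem_homog {k : ℕ} {v : List α → ℂ} (p : ℕ) (hv : v ∈ homog α k) :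
    cup p v ∈ homog α (k + 1) :=
  fun w hw => cup_eq_zero p v w fun c hc => hv c (by omega)

lemma cap_homog_zero {v : List α → ℂ} (p : ℕ) (hv : v ∈ homog α 0) : cap p v = 0 :=
  funext fun w => cap_eq_zero p v w fun c hc => hv c (by omega)

/-- The Temperley–Lieb relations allow to move every `cap` to the right of every `cup`. -/
lemma cap_cup (p q k : ℕ) : ∃ (c d : ℂ) (q' p' : ℕ), ∀ v ∈ homog α k,
    cap p (cup q v) = c • v + d • cup q' (cap p' v) := by
  have hid : ∀ k p q, (∀ (v : List α → ℂ) w, w ≠ [] → cap p (cup q v) w = v w) →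
      (∀ v : List α → ℂ, cap p (cup q v) [] = 0) →
      ∃ (c d : ℂ) (q' p' : ℕ), ∀ v ∈ homog α k,
        cap p (cup q v) = c • v + d • cup q' (cap p' v) := by
    intro k p q h h0
    rcases k with _ | k
    · refine ⟨0, 0, 0, 0, fun v hv => ?_⟩
      ext w
      rcases w with _ | ⟨i, w⟩
      · simp [h0]
      · simpa [h v (i :: w) (by simp)] using hv _ (by simp)
    · refine ⟨1, 0, 0, 0, fun v hv => ?_⟩
      ext w
      rcases w with _ | ⟨i, w⟩
      · simpa [h0] using (hv [] (by simp)).symm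
      · simp [h]
  have hcomm : ∀ k p q q' p', (∀ v : List α → ℂ, cap p (cup q v) = cup q' (cap p' v)) →
      ∃ (c d : ℂ) (q' p' : ℕ), ∀ v ∈ homog α k,
        cap p (cup q v) = c • v + d • cup q' (cap p' v) :=
    fun k p q q' p' h => ⟨0, 1, q', p', fun v _ => by simp [h]⟩
  induction p using Nat.twoStepInduction generalizing q k with
  | zero =>
    rcases q with _ | _ | q
    · refine ⟨Fintype.card α, 0, 0, 0, fun v _ => ?_⟩
      ext w; simp [cap_zero]
    · refine hid _ _ _ (fun v w hw => ?_) fun v => by simp [cap_zero]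
      obtain ⟨i, w, rfl⟩ := List.exists_cons_of_ne_nil hw
      simp [cap_zero]
    · refine hcomm _ _ _ q 0 fun v => ?_
      ext w
      have := map_cup (E := α → ℂ) (F := ℂ)
        { toFun := fun x => ∑ i, x i, map_zero' := by simp,
          map_add' := fun x y => by simp [Finset.sum_add_distrib] } q (fun w i => v (i :: w)) w
      simp only [AddMonoidHom.coe_mk, ZeroHom.coe_mk] at this
      simp only [cap_zero, cup_add_two_cons]
      rw [show (cap 0 v) = fun w' => ∑ i, v (i :: w') from funext (cap_zero v), ← this]
      exact Finset.sum_congr rfl fun i _ =>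
        (map_cup (Pi.evalAddMonoidHom _ i) q (fun w i => v (i :: w)) w).symm
  | one =>
    rcases q with _ | _ | _ | _ | q
    · exact hid _ _ _ (fun v w hw => by
        obtain ⟨i, w, rfl⟩ := List.exists_cons_of_ne_nil hw; simp) fun v => by simp
    · exact hid _ _ _ (fun v w hw => by
        obtain ⟨i, w, rfl⟩ := List.exists_cons_of_ne_nil hw; simp) fun v => by simp
    · exact hid _ _ _ (fun v w hw => by
        obtain ⟨i, w, rfl⟩ := List.exists_cons_of_ne_nil hw; simp) fun v => by simp
    · refine hcomm _ _ _ 1 1 fun v => ?_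
      ext w
      rcases w with _ | ⟨i, _ | ⟨j, w⟩⟩
      · simp
      · simp
      · by_cases h : i = j
        · subst h; simp
        · simp [h]
    · refine hcomm _ _ _ (q + 2) 1 fun v => ?_
      ext w
      cases w <;> simp
  | more p ih _ =>
    rcases q with _ | _ | q
    · refine hcomm _ _ _ 0 p fun v => ?_
      ext w
      cases w <;> simp
    · rcases p with _ | _ | p
      · exact hid _ _ _ (fun v w hw => by
          obtain ⟨i, w, rfl⟩ := List.exists_cons_of_ne_nil hw; simp [cap_zero]) fun v => by simp
      · refine hcomm _ _ _ 1 1 fun v => ?_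
        ext w
        rcases w with _ | ⟨i, _ | ⟨j, w⟩⟩
        · simp
        · simp
        · by_cases h : i = j
          · subst h; simp
          · simp [h]
      · refine hcomm _ _ _ 1 (p + 2) fun v => ?_
        ext w
        rcases w with _ | ⟨i, _ | ⟨j, w⟩⟩
        · simp
        · simp
        · by_cases h : i = j
          · subst h; simp
          · simpa [h] using cap_eq_zero p _ w fun _ _ => rfl
    · rcases k with _ | k
      · refine ⟨0, 0, 0, 0, fun v hv => ?_⟩
        ext w
        rcases w with _ | ⟨i, w⟩
        · simp
        · simp only [cap_add_two_cons, cup_add_two_cons, zero_smul, add_zero, Pi.zero_apply]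
          exact cap_eq_zero p _ w fun c _ => cup_eq_zero _ _ _ fun c' _ => hv _ (by simp)
      · obtain ⟨c, d, q', p', h⟩ := ih q k
        refine ⟨c, d, q' + 2, p' + 2, fun v hv => ?_⟩
        ext w
        rcases w with _ | ⟨i, w⟩
        · simp [hv [] (by simp)]
        · simpa using congrFun (h _ (homog_cons hv i)) w

section Words

variable (α) in
/-- Putting a letter in front of a word. -/
def consEmbedding : α × List α ↪ List α where
  toFun p := p.1 :: p.2
  inj' p q h := by
    simp only [List.cons.injEq] at h
    exact Prod.ext h.1 h.2

@[simp] lemma consEmbedding_apply (p : α × List α) : consEmbedding α p = p.1 :: p.2 := rfl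

variable (α) in
/-- The words of length `k`. -/
def words : ℕ → Finset (List α)
  | 0 => {[]}
  | k + 1 => (Finset.univ ×ˢ words k).map (consEmbedding α)

@[simp] lemma mem_words {k : ℕ} {w : List α} : w ∈ words α k ↔ w.length = k := by
  induction k generalizing w with
  | zero => simp [words]
  | succ k ih => cases w <;> simp [words, ih]

lemma sum_words_zero {E : Type*} [AddCommMonoid E] (f : List α → E) :
    ∑ w ∈ words α 0, f w = f [] := by
  simp [words]

lemma sum_words_succ {E : Type*} [AddCommMonoid E] (k : ℕ) (f : List α → E) :
    ∑ w ∈ words α (k + 1), f w = ∑ i, ∑ w ∈ words α k, f (i :: w) := by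
  simp [words, Finset.sum_product]

lemma sum_words_cap (p k : ℕ) (x y : List α → ℂ) :
    ∑ w ∈ words α k, x w * cap p y w = ∑ w ∈ words α (k + 1), cup p x w * y w := by
  induction p using Nat.twoStepInduction generalizing k x y with
  | zero =>
    simp only [sum_words_succ, cap_zero, cup_zero_cons, Finset.mul_sum]
    exact Finset.sum_comm
  | one =>
    rcases k with _ | k
    · simp [sum_words_zero, sum_words_succ]
    · simp only [sum_words_succ, cap_one_cons, cup_one_cons_cons]
      refine Finset.sum_congr rfl fun i _ => ?_
      rw [Finset.sum_eq_single i]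
      · simp
      · intro j _ hj; simp [hj.symm]
      · simp
  | more p ih _ =>
    rcases k with _ | k
    · simp [sum_words_zero, sum_words_succ]
    · rw [sum_words_succ, sum_words_succ]
      exact Finset.sum_congr rfl fun i _ => by simpa using ih k _ _

lemma sum_words_conj_cap (p k : ℕ) (x y : List α → ℂ) :
    ∑ w ∈ words α k, star (x w) * cap p y w =
      ∑ w ∈ words α (k + 1), star (cup p x w) * y w := by
  rw [sum_words_cap]
  exact Finset.sum_congr rfl fun w _ => by
    rw [show star (cup p x w) = cup p (fun w => star (x w)) w from
      map_cup (starRingEnd ℂ : ℂ →+ ℂ) p x w]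

lemma sum_words_conj_cup (p k : ℕ) (x y : List α → ℂ) :
    ∑ w ∈ words α (k + 1), star (x w) * cup p y w =
      ∑ w ∈ words α k, star (cap p x w) * y w := by
  have := congrArg star (sum_words_conj_cap p k y x)
  simpa [mul_comm] using this.symm

lemma eq_zero_of_sum_words_conj {k : ℕ} {x : List α → ℂ} (hx : x ∈ homog α k)
    (h : ∑ w ∈ words α k, star (x w) * x w = 0) : x = 0 := by
  ext w
  by_cases hw : w.length = k
  · have h' : ∑ w ∈ words α k, Complex.normSq (x w) = 0 := by
      have : ((∑ w ∈ words α k, Complex.normSq (x w) : ℝ) : ℂ) = 0 := by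
        push_cast
        rw [← h]
        exact Finset.sum_congr rfl fun w _ => Complex.normSq_eq_conj_mul_self
      exact_mod_cast this
    rw [Finset.sum_eq_zero_iff_of_nonneg fun _ _ => Complex.normSq_nonneg _] at h'
    exact Complex.normSq_eq_zero.1 (h' w (mem_words.2 hw))
  · exact hx w hw

/-- Every space of functions on the words of length `k` has a reproducing kernel. -/
lemma exists_kernel (k : ℕ) (G : Submodule ℂ (List α → ℂ)) (hG : G ≤ homog α k) :
    ∃ T : List α → List α → ℂ, (∀ b, T b ∈ G) ∧
      ∀ y ∈ G, ∀ b, ∑ w ∈ words α k, star (y w) * T b w = star (y b) := by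
  let res : (List α → ℂ) →ₗ[ℂ] EuclideanSpace ℂ (words α k) :=
    (WithLp.linearEquiv 2 ℂ (words α k → ℂ)).symm.toLinearMap ∘ₗ
      LinearMap.funLeft ℂ ℂ (Subtype.val : words α k → List α)
  have hres : ∀ x w, res x w = x w := fun x w => rfl
  let S := G.map res
  have key : ∀ b : List α, ∃ t ∈ G, ∀ y ∈ G, ∑ w ∈ words α k, star (y w) * t w = star (y b) := by
    intro b
    by_cases hb : b.length = k
    · let δ : EuclideanSpace ℂ (words α k) := EuclideanSpace.single ⟨b, mem_words.2 hb⟩ 1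
      obtain ⟨t, ht, hte⟩ := (S.orthogonalProjectionOnto δ).2
      refine ⟨t, ht, fun y hy => ?_⟩
      have h1 : inner ℂ (res y) (S.orthogonalProjectionOnto δ : EuclideanSpace ℂ (words α k)) =
          inner ℂ (res y) δ := by
        have := S.inner_orthogonalProjectionOnto_eq_of_mem_left
          (⟨res y, Submodule.mem_map_of_mem hy⟩ : S) δ
        exact this
      rw [← hte] at h1
      rw [PiLp.inner_apply, EuclideanSpace.inner_single_right] at h1
      rw [← Finset.sum_coe_sort]
      simpa [hres, mul_comm] using h1
    · exact ⟨0, G.zero_mem, fun y hy => by simp [hG hy b hb]⟩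
  choose T h1 h2 using key
  exact ⟨T, h1, fun y hy b => h2 b y hy⟩

/-- A reproducing kernel reproduces. -/
lemma kernel_repr {k : ℕ} {G : Submodule ℂ (List α → ℂ)} {T : List α → List α → ℂ}
    (hT : ∀ b, T b ∈ G)
    (h : ∀ y ∈ G, ∀ b, ∑ w ∈ words α k, star (y w) * T b w = star (y b))
    {x : List α → ℂ} (hx : x ∈ G) (a : List α) :
    x a = ∑ b ∈ words α k, x b * T b a := by
  have hsymm : ∀ a b, T b a = star (T a b) := by
    intro a b
    have h1 := h _ (hT a) b
    have h2 := congrArg star (h _ (hT b) a)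
    simp only [star_sum, star_mul', star_star] at h2
    rw [← h2, ← h1]
    exact Finset.sum_congr rfl fun w _ => mul_comm _ _
  have h3 := congrArg star (h x hx a)
  simp only [star_sum, star_mul', star_star] at h3
  rw [← h3]
  exact Finset.sum_congr rfl fun w _ => by rw [hsymm a w]

end Words

section Harmonic

/-- The functions obtained from a function of words by fixing the first letter. -/
def slice (i : α) : (List α → ℂ) →ₗ[ℂ] (List α → ℂ) := LinearMap.funLeft ℂ ℂ (List.cons i)

@[simp] lemma slice_apply (i : α) (v : List α → ℂ) (w : List α) : slice i v w = v (i :: w) := rfl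

/-- The function of words with prescribed slices and no constant term. -/
def glue (W : α → List α → ℂ) : List α → ℂ
  | [] => 0
  | i :: w => W i w

@[simp] lemma slice_glue (W : α → List α → ℂ) (i : α) : slice i (glue W) = W i := rfl

variable (α) in
/-- The functions supported on words of length `m` and killed by all `cap`s. -/
def harm (m : ℕ) : Submodule ℂ (List α → ℂ) := homog α m ⊓ ⨅ p, LinearMap.ker (capₗ α ℂ p)

lemma mem_harm {m : ℕ} {v : List α → ℂ} : v ∈ harm α m ↔ v ∈ homog α m ∧ ∀ p, cap p v = 0 := by
  simp [harm]

lemma harm_le_homog (m : ℕ) : harm α m ≤ homog α m := inf_le_left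

lemma mem_harm_zero {v : List α → ℂ} : v ∈ harm α 0 ↔ v ∈ homog α 0 :=
  ⟨fun h => (mem_harm.1 h).1, fun h => mem_harm.2 ⟨h, fun p => cap_homog_zero p h⟩⟩

lemma mem_harm_succ {m : ℕ} {v : List α → ℂ} :
    v ∈ harm α (m + 1) ↔ v [] = 0 ∧ (∀ i, slice i v ∈ harm α m) ∧
      (∀ i, slice i (slice i v) = 0) ∧ ∑ i, slice i v = 0 := by
  constructor
  · intro h
    obtain ⟨h1, h2⟩ := mem_harm.1 h
    refine ⟨h1 _ (by simp), fun i => mem_harm.2 ⟨homog_cons h1 i, fun p => ?_⟩, fun i => ?_, ?_⟩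
    · ext w
      have := congrFun (h2 (p + 2)) (i :: w)
      rwa [cap_add_two_cons] at this
    · ext w
      have := congrFun (h2 1) (i :: w)
      simpa using this
    · ext w
      have := congrFun (h2 0) w
      simpa [cap_zero] using this
  · rintro ⟨h0, h1, h2, h3⟩
    refine mem_harm.2 ⟨fun w hw => ?_, fun p => ?_⟩
    · cases w with
      | nil => exact h0
      | cons i w => exact (mem_harm.1 (h1 i)).1 w (by simpa using hw)
    · ext w
      rcases p with _ | _ | p
      · simpa [cap_zero] using congrFun h3 w
      · cases w with
        | nil => rfl
        | cons i w => exact congrFun (h2 i) w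
      · cases w with
        | nil => simp
        | cons i w =>
          rw [cap_add_two_cons]
          exact congrFun ((mem_harm.1 (h1 i)).2 p) w

lemma star_mem_harm {m : ℕ} {v : List α → ℂ} (hv : v ∈ harm α m) :
    (fun w => star (v w)) ∈ harm α m := by
  obtain ⟨h1, h2⟩ := mem_harm.1 hv
  refine mem_harm.2 ⟨fun w hw => by simp [h1 w hw], fun p => ?_⟩
  ext w
  have := map_cap (starRingEnd ℂ : ℂ →+ ℂ) p v w
  rw [h2 p] at this
  simpa using this.symm

/-- The elements of `harm α m` vanishing on words with first letter `i`. -/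
def harmAt (m : ℕ) (i : α) : Submodule ℂ (List α → ℂ) := harm α m ⊓ LinearMap.ker (slice i)

lemma mem_harmAt {m : ℕ} {i : α} {v : List α → ℂ} :
    v ∈ harmAt m i ↔ v ∈ harm α m ∧ slice i v = 0 := by
  simp [harmAt]

lemma slice_mem_harmAt {m : ℕ} {v : List α → ℂ} (hv : v ∈ harm α (m + 1)) (i : α) :
    slice i v ∈ harmAt m i :=
  mem_harmAt.2 ⟨(mem_harm_succ.1 hv).2.1 i, (mem_harm_succ.1 hv).2.2.1 i⟩

lemma glue_mem_harm {m : ℕ} {W : α → List α → ℂ} (h : ∀ i, W i ∈ harmAt m i)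
    (hs : ∑ i, W i = 0) : glue W ∈ harm α (m + 1) :=
  mem_harm_succ.2 ⟨rfl, fun i => (mem_harmAt.1 (h i)).1, fun i => (mem_harmAt.1 (h i)).2, hs⟩

lemma exists_two_avoid (hα : 4 ≤ Fintype.card α) (i j : α) :
    ∃ l l', l ≠ l' ∧ l ≠ i ∧ l ≠ j ∧ l' ≠ i ∧ l' ≠ j := by
  have h : 1 < (Finset.univ \ {i, j} : Finset α).card := by
    have h1 := Finset.le_card_sdiff ({i, j} : Finset α) Finset.univ
    have h2 := Finset.card_le_two (a := i) (b := j)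
    rw [Finset.card_univ] at h1
    omega
  obtain ⟨l, hl, l', hl', hne⟩ := Finset.one_lt_card.1 h
  simp at hl hl'
  exact ⟨l, l', hne, hl.1, hl.2, hl'.1, hl'.2⟩

lemma glue_triple_mem {m : ℕ} {j l l' : α} (h1 : j ≠ l) (h2 : j ≠ l') (h3 : l ≠ l')
    {x y z : List α → ℂ} (hz : z ∈ harmAt m j) (hx : x ∈ harmAt m l) (hy : y ∈ harmAt m l')
    (h : z = x + y) :
    glue (Pi.single j z - Pi.single l x - Pi.single l' y) ∈ harm α (m + 1) := by
  refine glue_mem_harm (fun i => ?_) ?_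
  · by_cases e1 : i = j
    · subst e1; simpa [h1, h2] using hz
    by_cases e2 : i = l
    · subst e2; simpa [h1.symm, h3] using hx
    by_cases e3 : i = l'
    · subst e3; simpa [h2.symm, h3.symm] using hy
    simp [e1, e2, e3]
  · simp [Finset.sum_sub_distrib, h]

lemma exists_add_of_mem_harm (hα : 4 ≤ Fintype.card α) (m : ℕ) {i j : α} (hij : i ≠ j)
    {v : List α → ℂ} (hv : v ∈ harm α m) :
    ∃ x ∈ harmAt m i, ∃ y ∈ harmAt m j, v = x + y := by
  induction m generalizing i j v with
  | zero =>
    refine ⟨v, mem_harmAt.2 ⟨hv, ?_⟩, 0, Submodule.zero_mem _, by simp⟩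
    ext w
    exact mem_harm_zero.1 hv _ (by simp)
  | succ m ih =>
    obtain ⟨l, l', h1, h2, h3, h4, h5⟩ := exists_two_avoid hα i j
    have hz := slice_mem_harmAt hv j
    obtain ⟨x, hx, y, hy, hxy⟩ := ih h1 (mem_harmAt.1 hz).1
    have hg := glue_triple_mem h3.symm h5.symm h1 hz hx hy hxy
    refine ⟨_, mem_harmAt.2 ⟨hg, ?_⟩, v - _, mem_harmAt.2 ⟨Submodule.sub_mem _ hv hg, ?_⟩,
      (add_sub_cancel _ v).symm⟩
    · simp [hij, h2.symm, h4.symm]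
    · simp [h3.symm, h5.symm]

lemma exists_slice_eq (hα : 4 ≤ Fintype.card α) (m : ℕ) {i : α}
    {w : List α → ℂ} (hw : w ∈ harmAt m i) : ∃ v ∈ harm α (m + 1), slice i v = w := by
  obtain ⟨l, l', h1, h2, -, h4, -⟩ := exists_two_avoid hα i i
  obtain ⟨x, hx, y, hy, hxy⟩ := exists_add_of_mem_harm hα m h1 (mem_harmAt.1 hw).1
  exact ⟨_, glue_triple_mem h2.symm h4.symm h1 hw hx hy hxy, by simp [h2.symm, h4.symm]⟩

end Harmonic

section Kernel

/-- The functions obtained from `v` by successive insertions. -/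
inductive Gen (m : ℕ) (v : List α → ℂ) : ℕ → (List α → ℂ) → Prop
  | base : Gen m v m v
  | cup (p k : ℕ) (x : List α → ℂ) : Gen m v k x → Gen m v (k + 1) (cup p x)

/-- The span of the functions on words of length `k` obtained from `v` by insertions. -/
def gen (m : ℕ) (v : List α → ℂ) (k : ℕ) : Submodule ℂ (List α → ℂ) :=
  Submodule.span ℂ {x | Gen m v k x}

variable {m : ℕ} {v : List α → ℂ}

lemma gen_le_homog (hv : v ∈ harm α m) (k : ℕ) : gen m v k ≤ homog α k := by
  refine Submodule.span_le.2 fun x hx => ?_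
  induction hx with
  | base => exact harm_le_homog m hv
  | cup p k x _ ih => exact cup_mem_homog p ih

lemma cup_mem_gen (p : ℕ) {k : ℕ} {x : List α → ℂ} (hx : x ∈ gen m v k) :
    cup p x ∈ gen m v (k + 1) := by
  have : gen m v k ≤ (gen m v (k + 1)).comap (cupₗ α ℂ p) :=
    Submodule.span_le.2 fun x hx => Submodule.subset_span (Gen.cup p k x hx)
  exact this hx

lemma cap_mem_gen (hv : v ∈ harm α m) (p : ℕ) {k : ℕ} {x : List α → ℂ}
    (hx : x ∈ gen m v (k + 1)) : cap p x ∈ gen m v k := by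
  have key : ∀ k x, Gen m v k x → ∀ p, cap p x ∈ gen m v (k - 1) := by
    intro k x h
    induction h with
    | base => intro p; simp [(mem_harm.1 hv).2 p]
    | cup q k x hx ih =>
      intro p
      obtain ⟨c, d, q', p', h⟩ := cap_cup (α := α) p q k
      have hxk : x ∈ gen m v k := Submodule.subset_span hx
      rw [h x (gen_le_homog hv k hxk)]
      refine Submodule.add_mem _ (Submodule.smul_mem _ _ hxk) (Submodule.smul_mem _ _ ?_)
      rcases k with _ | k
      · rw [cap_homog_zero p' (gen_le_homog hv 0 hxk), cup_zero_fun]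
        exact Submodule.zero_mem _
      · exact cup_mem_gen q' (ih p')
  have : gen m v (k + 1) ≤ (gen m v k).comap (capₗ α ℂ p) :=
    Submodule.span_le.2 fun x hx => key _ x hx p
  exact this hx

lemma Gen.le_and_eq {k : ℕ} {x : List α → ℂ} (h : Gen m v k x) : m ≤ k ∧ (k = m → x = v) := by
  induction h with
  | base => exact ⟨le_rfl, fun _ => rfl⟩
  | cup p k x _ ih => exact ⟨by omega, fun h => by omega⟩

lemma gen_eq_bot {k : ℕ} (hk : k < m) : gen m v k = ⊥ := by
  refine Submodule.span_eq_bot.2 fun x hx => ?_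
  have := (Gen.le_and_eq hx).1
  omega

lemma gen_self_le : gen m v m ≤ Submodule.span ℂ {v} :=
  Submodule.span_le.2 fun x hx => by
    rw [(Gen.le_and_eq hx).2 rfl]
    exact Submodule.mem_span_singleton_self v

/-- The families of functions of words on which the generators `u i j` act by prepending letters. -/
def Intertwines (Ψ : List α → List α → ℂ) : Prop :=
  ∀ p b, cap p (Ψ b) = cup p Ψ b ∧ cup p (Ψ b) = cap p Ψ b

lemma exists_intertwines (hv : v ∈ harm α m) :
    ∃ Ψ : List α → List α → ℂ, Intertwines Ψ ∧ (∀ b, b.length < m → Ψ b = 0) ∧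
      ∀ a b, b.length = m →
        (∑ w ∈ words α m, star (v w) * v w) * Ψ b a = v a * star (v b) := by
  choose T hT hr using fun k => exists_kernel k (gen m v k) (gen_le_homog hv k)
  let K : List α → List α → ℂ := fun b => T b.length b
  have hK : ∀ b, K b ∈ gen m v b.length := fun b => hT _ b
  have hKr : ∀ k, ∀ y ∈ gen m v k, ∀ b, ∑ w ∈ words α k, star (y w) * K b w = star (y b) := by
    intro k y hy b
    by_cases hb : b.length = k
    · subst hb; exact hr _ y hy b
    · rw [gen_le_homog hv k hy b hb, star_zero]
      refine Finset.sum_eq_zero fun w hw => ?_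
      rw [gen_le_homog hv _ (hK b) w (by rw [mem_words] at hw; omega), mul_zero]
  have hext : ∀ k, ∀ x ∈ gen m v k, ∀ x' ∈ gen m v k,
      (∀ y ∈ gen m v k, ∑ w ∈ words α k, star (y w) * x w = ∑ w ∈ words α k, star (y w) * x' w) →
      x = x' := by
    intro k x hx x' hx' h
    have hd := Submodule.sub_mem _ hx hx'
    refine sub_eq_zero.1 (eq_zero_of_sum_words_conj (gen_le_homog hv k hd) ?_)
    have := h _ hd
    simp only [Pi.sub_apply, mul_sub, Finset.sum_sub_distrib] at this ⊢
    rw [this, sub_self]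
  let pair : ℕ → (List α → ℂ) → ((List α → ℂ) →+ ℂ) := fun k y =>
    { toFun := fun x => ∑ w ∈ words α k, star (y w) * x w
      map_zero' := by simp
      map_add' := fun x x' => by simp [mul_add, Finset.sum_add_distrib] }
  have hpair : ∀ k, ∀ y ∈ gen m v k, (fun b => pair k y (K b)) = fun b => star (y b) :=
    fun k y hy => funext fun b => hKr k y hy b
  refine ⟨K, fun p b => ⟨?_, ?_⟩, fun b hb => ?_, fun a b hb => ?_⟩
  · rcases hb : b.length with _ | k
    · rw [List.length_eq_zero_iff] at hb
      subst hb
      rw [cup_nil, cap_homog_zero p (gen_le_homog hv 0 (hK []))]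
    · have hKb : K b ∈ gen m v (k + 1) := hb ▸ hK b
      refine hext k _ (cap_mem_gen hv p hKb) _ ?_ fun y hy => ?_
      · refine cup_mem (gen m v k).toAddSubmonoid p K b fun c hc => ?_
        have : c.length = k := by omega
        exact this ▸ hK c
      · rw [sum_words_conj_cap, hKr _ _ (cup_mem_gen p hy)]
        have := map_cup (pair k y) p K b
        rw [hpair k y hy] at this
        exact (map_cup (starRingEnd ℂ : ℂ →+ ℂ) p y b).trans this.symm
  · refine hext (b.length + 1) _ (cup_mem_gen p (hK b)) _ ?_ fun y hy => ?_
    · exact cap_mem (gen m v (b.length + 1)).toAddSubmonoid p K b fun c hc => hc ▸ hK c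
    · rw [sum_words_conj_cup, hKr _ _ (cap_mem_gen hv p hy)]
      have := map_cap (pair (b.length + 1) y) p K b
      rw [hpair _ y hy] at this
      exact (map_cap (starRingEnd ℂ : ℂ →+ ℂ) p y b).trans this.symm
  · have := hK b
    rwa [gen_eq_bot hb, Submodule.mem_bot] at this
  · have hKb : K b ∈ gen m v m := hb ▸ hK b
    obtain ⟨c, hc⟩ := Submodule.mem_span_singleton.1 (gen_self_le hKb)
    have h1 := hKr m v (Submodule.subset_span Gen.base) b
    rw [← hc] at h1 ⊢
    rw [← h1]
    simp only [Pi.smul_apply, smul_eq_mul, Finset.sum_mul, Finset.mul_sum]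
    exact Finset.sum_congr rfl fun w _ => by ring

end Kernel

end NCWord

namespace ASAlg

open NCWord

variable {n : ℕ}

lemma u_mul_u_row (i j k : Fin n) :
    ASu 0 i j * ASu 0 i k = if j = k then ASu (0 : Matrix (Fin n) (Fin n) ℂ) i j else 0 := by
  have := RingQuot.mkAlgHom_rel ℂ (ASRel.row_orth (d := 0) i j k)
  rw [map_mul] at this
  rw [ASu, ASu, this]
  split_ifs <;> simp

lemma u_mul_u_col (i j k : Fin n) :
    ASu 0 j i * ASu 0 k i = if j = k then ASu (0 : Matrix (Fin n) (Fin n) ℂ) j i else 0 := by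
  have := RingQuot.mkAlgHom_rel ℂ (ASRel.col_orth (d := 0) i j k)
  rw [map_mul] at this
  rw [ASu, ASu, this]
  split_ifs <;> simp

lemma sum_u_row (i : Fin n) : ∑ j, ASu (0 : Matrix (Fin n) (Fin n) ℂ) i j = 1 := by
  have := RingQuot.mkAlgHom_rel ℂ (ASRel.row_sum (d := 0) i)
  rwa [map_sum, map_one] at this

lemma sum_u_col (i : Fin n) : ∑ j, ASu (0 : Matrix (Fin n) (Fin n) ℂ) j i = 1 := by
  have := RingQuot.mkAlgHom_rel ℂ (ASRel.col_sum (d := 0) i)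
  rwa [map_sum, map_one] at this

lemma exists_lift {B : Type*} [Ring B] [Algebra ℂ B] (U : Fin n → Fin n → B)
    (h1 : ∀ i j k, U i j * U i k = if j = k then U i j else 0)
    (h2 : ∀ i j k, U j i * U k i = if j = k then U j i else 0)
    (h3 : ∀ i, ∑ j, U i j = 1) (h4 : ∀ i, ∑ j, U j i = 1) :
    ∃ F : ASAlg n 0 →ₐ[ℂ] B, ∀ i j, F (ASu 0 i j) = U i j := by
  refine ⟨RingQuot.liftAlgHom ℂ ⟨FreeAlgebra.lift ℂ fun p => U p.1 p.2, ?_⟩, fun i j => ?_⟩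
  · intro a b h
    induction h with
    | row_orth i j k =>
      rw [map_mul]
      simp only [FreeAlgebra.lift_ι_apply, h1, apply_ite (FreeAlgebra.lift ℂ _), map_zero]
    | col_orth i j k =>
      rw [map_mul]
      simp only [FreeAlgebra.lift_ι_apply, h2, apply_ite (FreeAlgebra.lift ℂ _), map_zero]
    | row_sum i => simp [FreeAlgebra.lift_ι_apply, h3]
    | col_sum i => simp [FreeAlgebra.lift_ι_apply, h4]
    | inter i j => simp
  · simp [ASu, RingQuot.liftAlgHom_mkAlgHom_apply, FreeAlgebra.lift_ι_apply]

lemma adjoin_eq_top (S : Subalgebra ℂ (ASAlg n 0)) (h : ∀ i j, ASu 0 i j ∈ S) (a : ASAlg n 0) :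
    a ∈ S := by
  obtain ⟨x, rfl⟩ := RingQuot.mkAlgHom_surjective ℂ (ASRel n 0) a
  induction x using FreeAlgebra.induction with
  | grade0 r => rw [AlgHom.commutes]; exact S.algebraMap_mem r
  | grade1 p => exact h p.1 p.2
  | mul x y hx hy => rw [map_mul]; exact S.mul_mem hx hy
  | add x y hx hy => rw [map_add]; exact S.add_mem hx hy

lemma mem_of_mul_u_mem (S : Submodule ℂ (ASAlg n 0)) (h1 : 1 ∈ S)
    (h : ∀ x ∈ S, ∀ i j, x * ASu 0 i j ∈ S) (a : ASAlg n 0) : a ∈ S := by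
  let R : Subalgebra ℂ (ASAlg n 0) :=
    { carrier := {a | ∀ x ∈ S, x * a ∈ S}
      mul_mem' := fun {a b} ha hb x hx => by rw [← mul_assoc]; exact hb _ (ha _ hx)
      add_mem' := fun {a b} ha hb x hx => by rw [mul_add]; exact S.add_mem (ha _ hx) (hb _ hx)
      algebraMap_mem' := fun r x hx => by
        rw [← Algebra.commutes, ← Algebra.smul_def]; exact S.smul_mem _ hx }
  have := adjoin_eq_top R (fun i j x hx => h x hx i j) a 1 h1
  rwa [one_mul] at this

/-- The product of generators with rows and columns prescribed by two words, read backwards. -/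
noncomputable def mon : List (Fin n) → List (Fin n) → ASAlg n 0
  | [], [] => 1
  | i :: a, j :: b => mon a b * ASu 0 i j
  | _, _ => 0

@[simp] lemma mon_nil : mon ([] : List (Fin n)) [] = 1 := rfl

@[simp] lemma mon_cons (i j : Fin n) (a b : List (Fin n)) :
    mon (i :: a) (j :: b) = mon a b * ASu 0 i j := rfl

variable (n) in
/-- The space of families of functions satisfying `Intertwines`. -/
def intertwiners : Submodule ℂ (List (Fin n) → List (Fin n) → ℂ) where
  carrier := {Ψ | Intertwines Ψ}
  zero_mem' := fun p b => ⟨by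
      rw [cup_zero_fun]; exact map_zero (capₗ (Fin n) ℂ p), by
      rw [show cap p (0 : List (Fin n) → List (Fin n) → ℂ) = 0 from map_zero (capₗ _ _ p)]
      exact cup_zero_fun p⟩
  add_mem' := fun {Ψ Ψ'} h h' p b => by
    rw [cup_add, cap_add]
    simp only [Pi.add_apply]
    rw [cup_add, cap_add, (h p b).1, (h p b).2, (h' p b).1, (h' p b).2]
    exact ⟨rfl, rfl⟩
  smul_mem' := fun c Ψ h p b => by
    rw [cup_smul, cap_smul]
    simp only [Pi.smul_apply]
    rw [cup_smul, cap_smul, (h p b).1, (h p b).2]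
    exact ⟨rfl, rfl⟩

/-- Prepending letters to both words. -/
def prepend (i j : Fin n) : intertwiners n →ₗ[ℂ] intertwiners n :=
  LinearMap.restrict
    (⟨⟨fun Ψ b => slice i (Ψ (j :: b)), fun _ _ => rfl⟩, fun _ _ => rfl⟩ :
      (List (Fin n) → List (Fin n) → ℂ) →ₗ[ℂ] (List (Fin n) → List (Fin n) → ℂ))
    (fun Ψ h p b => by
      have e1 := map_cup (slice i : (List (Fin n) → ℂ) →ₗ[ℂ] _).toAddMonoidHom p
        (fun b => Ψ (j :: b)) b
      have e2 := map_cap (slice i : (List (Fin n) → ℂ) →ₗ[ℂ] _).toAddMonoidHom p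
        (fun b => Ψ (j :: b)) b
      have e3 := h (p + 2) (j :: b)
      rw [cup_add_two_cons, cap_add_two_cons] at e3
      constructor
      · ext a
        refine Eq.trans ?_ (congrFun e1 a)
        have := congrFun e3.1 (i :: a)
        rwa [cap_add_two_cons] at this
      · ext a
        refine Eq.trans ?_ (congrFun e2 a)
        have := congrFun e3.2 (i :: a)
        rwa [cup_add_two_cons] at this)

lemma prepend_apply (i j : Fin n) (Ψ : intertwiners n) (a b : List (Fin n)) :
    (prepend i j Ψ).1 b a = Ψ.1 (j :: b) (i :: a) := rfl

variable (n) in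
lemma exists_prepend_action : ∃ ρ : ASAlg n 0 →ₐ[ℂ] Module.End ℂ (intertwiners n),
    ∀ i j, ρ (ASu 0 i j) = prepend i j := by
  refine exists_lift (B := Module.End ℂ (intertwiners n)) prepend (fun i j k => ?_)
    (fun i j k => ?_) (fun i => ?_) fun i => ?_
  · ext Ψ b a
    have := congrFun (Ψ.2 1 (k :: j :: b)).1 (i :: a)
    simp only [Module.End.mul_apply, prepend_apply]
    rw [cap_one_cons, cup_one_cons_cons] at this
    rw [this]
    split_ifs with h1 h2 h2
    · rfl
    · exact absurd h1.symm h2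
    · exact absurd h2.symm h1
    · rfl
  · ext Ψ b a
    have := congrFun (Ψ.2 1 (i :: b)).2 (k :: j :: a)
    simp only [Module.End.mul_apply, prepend_apply]
    rw [cap_one_cons, cup_one_cons_cons] at this
    rw [← this]
    split_ifs with h1 h2 h2
    · rfl
    · exact absurd h1.symm h2
    · exact absurd h2.symm h1
    · rfl
  · ext Ψ b a
    have := congrFun (Ψ.2 0 b).2 (i :: a)
    rw [cap_zero, cup_zero_cons, Finset.sum_apply] at this
    simpa [LinearMap.sum_apply, prepend_apply, Submodule.coe_sum, Finset.sum_apply] using this.symm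
  · ext Ψ b a
    have := congrFun (Ψ.2 0 (i :: b)).1 a
    rw [cap_zero, cup_zero_cons] at this
    simpa [LinearMap.sum_apply, prepend_apply, Submodule.coe_sum, Finset.sum_apply] using this

lemma exists_functional_intertwiner (Ψ : intertwiners n) : ∃ φ : ASAlg n 0 →ₗ[ℂ] ℂ,
    ∀ a b : List (Fin n), a.length = b.length → φ (mon a b) = Ψ.1 b a := by
  obtain ⟨ρ, hρ⟩ := exists_prepend_action n
  refine ⟨LinearMap.proj [] ∘ₗ LinearMap.proj [] ∘ₗ (intertwiners n).subtype ∘ₗ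
    LinearMap.applyₗ Ψ ∘ₗ ρ.toLinearMap, fun a => ?_⟩
  simp only [LinearMap.comp_apply, LinearMap.proj_apply, Submodule.subtype_apply,
    LinearMap.applyₗ_apply_apply, AlgHom.toLinearMap_apply]
  induction a generalizing Ψ with
  | nil =>
    intro b hb
    rw [List.length_nil, eq_comm, List.length_eq_zero_iff] at hb
    subst hb
    simp
  | cons i a ih =>
    intro b hb
    rcases b with _ | ⟨j, b⟩
    · simp at hb
    · rw [mon_cons, map_mul, Module.End.mul_apply, hρ, ih _ b (by simpa using hb)]
      rfl

lemma exists_functional {m : ℕ} {v w : List (Fin n) → ℂ} (hv : v ∈ harm (Fin n) m)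
    (hw : w ∈ harm (Fin n) m) : ∃ φ : ASAlg n 0 →ₗ[ℂ] ℂ,
      (∀ a b : List (Fin n), a.length = b.length → a.length < m → φ (mon a b) = 0) ∧
      ∀ a b : List (Fin n), a.length = m → b.length = m → φ (mon a b) = v a * w b := by
  have hdiag : ∀ v : List (Fin n) → ℂ, v ∈ harm (Fin n) m → ∃ φ : ASAlg n 0 →ₗ[ℂ] ℂ,
      (∀ a b : List (Fin n), a.length = b.length → a.length < m → φ (mon a b) = 0) ∧
      ∀ a b : List (Fin n), a.length = m → b.length = m → φ (mon a b) = v a * star (v b) := by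
    intro v hv
    obtain ⟨Ψ, h1, h2, h3⟩ := exists_intertwines hv
    obtain ⟨φ, hφ⟩ := exists_functional_intertwiner ⟨Ψ, h1⟩
    by_cases h0 : ∑ w ∈ words (Fin n) m, star (v w) * v w = 0
    · have := eq_zero_of_sum_words_conj (harm_le_homog m hv) h0
      exact ⟨0, by simp, by simp [this]⟩
    · refine ⟨(∑ w ∈ words (Fin n) m, star (v w) * v w) • φ, fun a b hab ha => ?_,
        fun a b ha hb => ?_⟩
      · rw [LinearMap.smul_apply, hφ a b hab]
        simp only [h2 b (hab ▸ ha), Pi.zero_apply, smul_zero]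
      · rw [LinearMap.smul_apply, hφ a b (ha.trans hb.symm), smul_eq_mul]
        exact h3 a b hb
  have hw' := star_mem_harm hw
  choose φ h1 h2 using fun c : ℂ => hdiag _ (Submodule.add_mem _ hv (Submodule.smul_mem _ c hw'))
  refine ⟨(1 / 4 : ℂ) • (φ 1 + Complex.I • φ Complex.I - φ (-1) - Complex.I • φ (-Complex.I)),
    fun a b hab ha => by simp [h1 _ a b hab ha], fun a b ha hb => ?_⟩
  simp only [LinearMap.smul_apply, LinearMap.add_apply, LinearMap.sub_apply, h2 _ a b ha hb,
    smul_eq_mul, Pi.add_apply, Pi.smul_apply, star_add, star_mul', star_star, star_neg, star_one]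
  rw [show star Complex.I = -Complex.I from Complex.conj_I]
  linear_combination (1 / 2 * (star (w a) * star (v b) - v a * w b)) * Complex.I_sq

section LinearAlgebra

lemma exists_linear_splitting {E : Type*} [AddCommGroup E] [Module ℂ E] (p q : Submodule ℂ E) :
    ∃ l : E →ₗ[ℂ] E, ∀ v ∈ p ⊔ q, l v ∈ p ∧ v - l v ∈ q := by
  let f : (p × q) →ₗ[ℂ] ↥(p ⊔ q) := LinearMap.coprod
    (Submodule.inclusion le_sup_left) (Submodule.inclusion le_sup_right)
  have hf : Function.Surjective f := by
    rintro ⟨v, hv⟩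
    obtain ⟨x, hx, y, hy, rfl⟩ := Submodule.mem_sup.1 hv
    exact ⟨(⟨x, hx⟩, ⟨y, hy⟩), rfl⟩
  obtain ⟨g, hg⟩ := f.exists_rightInverse_of_surjective (LinearMap.range_eq_top.2 hf)
  obtain ⟨l, hl⟩ := LinearMap.exists_extend (p.subtype ∘ₗ LinearMap.fst ℂ p q ∘ₗ g)
  refine ⟨l, fun v hv => ?_⟩
  have h1 : l v = (g ⟨v, hv⟩).1 := LinearMap.congr_fun hl ⟨v, hv⟩
  have h2 : ((g ⟨v, hv⟩).1 : E) + (g ⟨v, hv⟩).2 = v :=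
    congrArg Subtype.val (LinearMap.congr_fun hg ⟨v, hv⟩)
  rw [h1]
  refine ⟨(g ⟨v, hv⟩).1.2, ?_⟩
  rw [sub_eq_of_eq_add' h2.symm]
  exact (g ⟨v, hv⟩).2.2

lemma exists_linear_section {E F : Type*} [AddCommGroup E] [Module ℂ E] [AddCommGroup F]
    [Module ℂ F] (f : E →ₗ[ℂ] F) (p : Submodule ℂ E) :
    ∃ s : F →ₗ[ℂ] E, ∀ v ∈ p, s (f v) ∈ p ∧ f (s (f v)) = f v := by
  let f' := (f.domRestrict p).rangeRestrict
  obtain ⟨g, hg⟩ := f'.exists_rightInverse_of_surjective (LinearMap.range_rangeRestrict _)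
  obtain ⟨s, hs⟩ := LinearMap.exists_extend (p.subtype ∘ₗ g)
  refine ⟨s, fun v hv => ?_⟩
  have h1 : s (f v) = g (f' ⟨v, hv⟩) := LinearMap.congr_fun hs (f' ⟨v, hv⟩)
  have h2 : f (g (f' ⟨v, hv⟩)) = f v :=
    congrArg Subtype.val (LinearMap.congr_fun hg (f' ⟨v, hv⟩))
  rw [h1]
  exact ⟨(g _).2, h2⟩

end LinearAlgebra

section Filtration

variable (n) in
/-- The span of the monomials of degree less than `m`. -/
def fil (m : ℕ) : Submodule ℂ (ASAlg n 0) :=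
  Submodule.span ℂ {z | ∃ a b : List (Fin n), a.length = b.length ∧ a.length < m ∧ z = mon a b}

lemma mon_mem_fil {m : ℕ} {a b : List (Fin n)} (h : a.length = b.length) (ha : a.length < m) :
    mon a b ∈ fil n m := Submodule.subset_span ⟨a, b, h, ha, rfl⟩

lemma fil_zero : fil n 0 = ⊥ := by
  rw [fil, Submodule.span_eq_bot]
  rintro x ⟨a, b, -, h, -⟩
  simp at h

lemma fil_mono {m k : ℕ} (h : m ≤ k) : fil n m ≤ fil n k := by
  refine Submodule.span_le.2 ?_
  rintro x ⟨a, b, h1, h2, rfl⟩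
  exact mon_mem_fil h1 (by omega)

lemma mul_u_mem_fil {m : ℕ} {z : ASAlg n 0} (hz : z ∈ fil n m) (i j : Fin n) :
    z * ASu 0 i j ∈ fil n (m + 1) := by
  have : fil n m ≤ (fil n (m + 1)).comap (LinearMap.mulRight ℂ (ASu 0 i j)) := by
    refine Submodule.span_le.2 ?_
    rintro x ⟨a, b, h1, h2, rfl⟩
    exact mon_mem_fil (a := i :: a) (b := j :: b) (by simpa using h1) (by simpa using h2)
  exact this hz

lemma exists_mem_fil (z : ASAlg n 0) : ∃ m, z ∈ fil n m := by
  let S : Submodule ℂ (ASAlg n 0) :=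
    { carrier := {z | ∃ m, z ∈ fil n m}
      zero_mem' := ⟨0, Submodule.zero_mem _⟩
      add_mem' := fun {x y} ⟨m, hm⟩ ⟨k, hk⟩ => ⟨max m k, Submodule.add_mem _
        (fil_mono (le_max_left _ _) hm) (fil_mono (le_max_right _ _) hk)⟩
      smul_mem' := fun c x ⟨m, hm⟩ => ⟨m, Submodule.smul_mem _ c hm⟩ }
  exact mem_of_mul_u_mem S ⟨1, mon_mem_fil (a := []) (b := []) rfl (by simp)⟩
    (fun x ⟨m, hm⟩ i j => ⟨m + 1, mul_u_mem_fil hm i j⟩) z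

variable (n) in
/-- Linear combinations of monomials of degree `m`. -/
noncomputable def comb (m : ℕ) : (List (Fin n) → List (Fin n) → ℂ) →ₗ[ℂ] ASAlg n 0 where
  toFun c := ∑ a ∈ words (Fin n) m, ∑ b ∈ words (Fin n) m, c a b • mon a b
  map_add' c d := by simp [add_smul, Finset.sum_add_distrib]
  map_smul' r c := by simp [mul_smul, Finset.smul_sum]

lemma comb_apply (m : ℕ) (c : List (Fin n) → List (Fin n) → ℂ) :
    comb n m c = ∑ a ∈ words (Fin n) m, ∑ b ∈ words (Fin n) m, c a b • mon a b := rfl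

lemma exists_comb_of_mem_fil_succ {m : ℕ} {z : ASAlg n 0} (hz : z ∈ fil n (m + 1)) :
    ∃ c, z - comb n m c ∈ fil n m := by
  have : fil n (m + 1) ≤ fil n m ⊔ LinearMap.range (comb n m) := by
    refine Submodule.span_le.2 ?_
    rintro x ⟨a, b, h1, h2, rfl⟩
    by_cases ha : a.length < m
    · exact Submodule.mem_sup_left (mon_mem_fil h1 ha)
    · have ha : a.length = m := by omega
      have hb : b.length = m := by omega
      refine Submodule.mem_sup_right ⟨Pi.single a (Pi.single b 1), ?_⟩
      rw [comb_apply, Finset.sum_eq_single a, Finset.sum_eq_single b]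
      · simp
      · intro b' _ hb'; simp [hb']
      · intro h; exact absurd (mem_words.2 hb) h
      · intro a' _ ha'; simp [ha']
      · intro h; exact absurd (mem_words.2 ha) h
  obtain ⟨x, hx, _, ⟨c, rfl⟩, rfl⟩ := Submodule.mem_sup.1 (this hz)
  exact ⟨c, by simpa using hx⟩

/-- The bilinear form with matrix `c` on functions of words of length `m`. -/
noncomputable def bil (m : ℕ) (c : List (Fin n) → List (Fin n) → ℂ) :
    (List (Fin n) → ℂ) →ₗ[ℂ] (List (Fin n) → ℂ) →ₗ[ℂ] ℂ :=
  LinearMap.mk₂ ℂ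
    (fun v w => ∑ a ∈ words (Fin n) m, ∑ b ∈ words (Fin n) m, c a b * (v a * w b))
    (fun v v' w => by simp [add_mul, mul_add, Finset.sum_add_distrib])
    (fun r v w => by
      simp only [Pi.smul_apply, smul_eq_mul, Finset.mul_sum]
      exact Finset.sum_congr rfl fun a _ => Finset.sum_congr rfl fun b _ => by ring)
    (fun v w w' => by simp [mul_add, Finset.sum_add_distrib])
    (fun r v w => by
      simp only [Pi.smul_apply, smul_eq_mul, Finset.mul_sum]
      exact Finset.sum_congr rfl fun a _ => Finset.sum_congr rfl fun b _ => by ring)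

lemma bil_apply (m : ℕ) (c : List (Fin n) → List (Fin n) → ℂ) (v w : List (Fin n) → ℂ) :
    bil m c v w =
      ∑ a ∈ words (Fin n) m, ∑ b ∈ words (Fin n) m, c a b * (v a * w b) := rfl

lemma bil_sub (m : ℕ) (c d : List (Fin n) → List (Fin n) → ℂ) (v w : List (Fin n) → ℂ) :
    bil m (c - d) v w = bil m c v w - bil m d v w := by
  simp [bil_apply, sub_mul, Finset.sum_sub_distrib]

lemma sum_smul_single {k : ℕ} {v : List (Fin n) → ℂ} (hv : v ∈ homog (Fin n) k) :
    ∑ x ∈ words (Fin n) k, v x • (Pi.single x 1 : List (Fin n) → ℂ) = v := by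
  ext w
  rw [Finset.sum_apply]
  by_cases hw : w.length = k
  · rw [Finset.sum_eq_single w]
    · simp
    · intro b _ hb; simp [hb.symm]
    · intro h; exact absurd (mem_words.2 hw) h
  · rw [hv w hw]
    refine Finset.sum_eq_zero fun x hx => ?_
    have : w ≠ x := by rintro rfl; exact hw (mem_words.1 hx)
    simp [this]

lemma exists_bil_eq (k : ℕ) (β : (List (Fin n) → ℂ) →ₗ[ℂ] (List (Fin n) → ℂ) →ₗ[ℂ] ℂ) :
    ∃ c, ∀ v ∈ homog (Fin n) k, ∀ w ∈ homog (Fin n) k, bil k c v w = β v w := by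
  refine ⟨fun a b => β (Pi.single a 1) (Pi.single b 1), fun v hv w hw => ?_⟩
  conv_rhs => rw [← sum_smul_single hv, ← sum_smul_single hw]
  rw [bil_apply]
  simp only [map_sum, LinearMap.sum_apply, map_smul, LinearMap.smul_apply, smul_eq_mul,
    Finset.mul_sum]
  rw [Finset.sum_comm]
  exact Finset.sum_congr rfl fun a _ => Finset.sum_congr rfl fun b _ => by ring

lemma cap_mon_left (p : ℕ) (w b : List (Fin n)) (h : b.length = w.length + 1) :
    cap p (fun a => mon a b) w = cup p (fun b => mon w b) b := by
  induction p using Nat.twoStepInduction generalizing w b with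
  | zero =>
    rcases b with _ | ⟨j, b⟩
    · simp at h
    · simp [cap_zero, ← Finset.mul_sum, sum_u_col]
  | one =>
    rcases w with _ | ⟨i, w⟩ <;> rcases b with _ | ⟨j, _ | ⟨k, b⟩⟩
    all_goals try simp at h
    · simp
    · rw [cap_one_cons, cup_one_cons_cons, mon_cons, mon_cons, mul_assoc, u_mul_u_row]
      split_ifs with h1 h2 h2
      · rw [h1]
      · exact absurd h1.symm h2
      · exact absurd h2.symm h1
      · simp
  | more p ih _ =>
    rcases w with _ | ⟨i, w⟩ <;> rcases b with _ | ⟨j, b⟩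
    · simp at h
    · have : b = [] := by simpa using h
      simp [this]
    · simp at h
    · have h' : b.length = w.length + 1 := by simpa using h
      rw [cap_add_two_cons, cup_add_two_cons]
      simp only [mon_cons]
      have e1 := map_cap (AddMonoidHom.mulRight (ASu 0 i j)) p (fun a => mon a b) w
      have e2 := map_cup (AddMonoidHom.mulRight (ASu 0 i j)) p (fun b => mon w b) b
      simp only [AddMonoidHom.mulRight_apply] at e1 e2
      rw [← e1, ← e2, ih w b h']

lemma cap_mon_right (p : ℕ) (a w : List (Fin n)) (h : a.length = w.length + 1) :
    cap p (fun b => mon a b) w = cup p (fun a => mon a w) a := by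
  induction p using Nat.twoStepInduction generalizing w a with
  | zero =>
    rcases a with _ | ⟨j, a⟩
    · simp at h
    · simp [cap_zero, ← Finset.mul_sum, sum_u_row]
  | one =>
    rcases w with _ | ⟨i, w⟩ <;> rcases a with _ | ⟨j, _ | ⟨k, a⟩⟩
    all_goals try simp at h
    · simp
    · rw [cap_one_cons, cup_one_cons_cons, mon_cons, mon_cons, mul_assoc, u_mul_u_col]
      split_ifs with h1 h2 h2
      · rw [h1]
      · exact absurd h1.symm h2
      · exact absurd h2.symm h1
      · simp
  | more p ih _ =>
    rcases w with _ | ⟨i, w⟩ <;> rcases a with _ | ⟨j, a⟩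
    · simp at h
    · have : a = [] := by simpa using h
      simp [this]
    · simp at h
    · have h' : a.length = w.length + 1 := by simpa using h
      rw [cap_add_two_cons, cup_add_two_cons]
      simp only [mon_cons]
      have e1 := map_cap (AddMonoidHom.mulRight (ASu 0 j i)) p (fun b => mon a b) w
      have e2 := map_cup (AddMonoidHom.mulRight (ASu 0 j i)) p (fun a => mon a w) a
      simp only [AddMonoidHom.mulRight_apply] at e1 e2
      rw [← e1, ← e2, ih a w h']

/-- The matrix coefficients of a functional vanishing in low degree are harmonic. -/
lemma coeff_mem_harm {m : ℕ} (θ : ASAlg n 0 →ₗ[ℂ] ℂ) (hθ : ∀ z ∈ fil n m, θ z = 0)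
    (b : List (Fin n)) (hb : b.length = m) :
    (fun a => if a.length = m then θ (mon a b) else 0) ∈ harm (Fin n) m ∧
      (fun a => if a.length = m then θ (mon b a) else 0) ∈ harm (Fin n) m := by
  have aux : ∀ g : List (Fin n) → ASAlg n 0,
      (∀ p w, w.length + 1 = m → cap p g w ∈ fil n m) →
      (fun a => if a.length = m then θ (g a) else 0) ∈ harm (Fin n) m := by
    intro g hg
    refine mem_harm.2 ⟨fun w hw => if_neg hw, fun p => ?_⟩
    ext w
    by_cases hw : w.length + 1 = m
    · have h1 := map_cap θ.toAddMonoidHom p g w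
      have h2 := cap_eq_zero p
        ((fun a => if a.length = m then θ (g a) else 0) - fun a => θ (g a)) w
        fun c hc => by simp [hc, hw]
      have h3 : cap p ((fun a => if a.length = m then θ (g a) else 0) - fun a => θ (g a)) =
        cap p (fun a => if a.length = m then θ (g a) else 0) - cap p (fun a => θ (g a)) :=
        map_sub (capₗ (Fin n) ℂ p) _ _
      rw [h3, Pi.sub_apply, sub_eq_zero] at h2
      rw [h2]
      exact h1.symm.trans (hθ _ (hg p w hw))
    · exact cap_eq_zero p _ w fun c hc => if_neg (by omega)
  refine ⟨aux _ fun p w hw => ?_, aux _ fun p w hw => ?_⟩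
  · rw [cap_mon_left p w b (by omega)]
    exact cup_mem (fil n m).toAddSubmonoid p _ b fun c hc =>
      mon_mem_fil (by omega) (by omega)
  · rw [cap_mon_right p b w (by omega)]
    exact cup_mem (fil n m).toAddSubmonoid p _ b fun c hc =>
      mon_mem_fil (by omega) (by omega)

lemma comb_mem_fil {m : ℕ} (c : List (Fin n) → List (Fin n) → ℂ)
    (h : ∀ v ∈ harm (Fin n) m, ∀ w ∈ harm (Fin n) m, bil m c v w = 0) :
    comb n m c ∈ fil n m := by
  by_contra hc
  obtain ⟨θ, hθ, hker⟩ := Submodule.exists_le_ker_of_notMem hc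
  obtain ⟨T, hT, hr⟩ := exists_kernel m (harm (Fin n) m) (harm_le_homog m)
  refine hθ ?_
  have ht := coeff_mem_harm θ fun z hz => hker hz
  have e1 : ∀ a ∈ words (Fin n) m, ∀ b ∈ words (Fin n) m, θ (mon a b) =
      ∑ a' ∈ words (Fin n) m, ∑ b' ∈ words (Fin n) m, θ (mon a' b') * (T a' a * T b' b) := by
    intro a ha b hb
    have h1 := kernel_repr hT hr (ht b (mem_words.1 hb)).1 a
    simp only [mem_words.1 ha, if_true] at h1
    rw [h1]
    refine Finset.sum_congr rfl fun a' ha' => ?_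
    have h2 := kernel_repr hT hr (ht a' (mem_words.1 ha')).2 b
    simp only [mem_words.1 hb, if_true] at h2
    rw [if_pos (mem_words.1 ha'), h2, Finset.sum_mul]
    exact Finset.sum_congr rfl fun b' hb' => by rw [if_pos (mem_words.1 hb')]; ring
  have e2 : θ (comb n m c) = ∑ a' ∈ words (Fin n) m, ∑ b' ∈ words (Fin n) m,
      θ (mon a' b') * bil m c (T a') (T b') := by
    simp only [comb_apply, map_sum, map_smul, smul_eq_mul, bil_apply, Finset.mul_sum]
    rw [Finset.sum_congr rfl fun a ha => Finset.sum_congr rfl fun b hb => by rw [e1 a ha b hb]]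
    simp only [Finset.mul_sum]
    rw [Finset.sum_congr rfl fun a _ => Finset.sum_comm, Finset.sum_comm]
    refine Finset.sum_congr rfl fun a' _ => ?_
    rw [Finset.sum_congr rfl fun a _ => Finset.sum_comm, Finset.sum_comm]
    exact Finset.sum_congr rfl fun b' _ => Finset.sum_congr rfl fun a _ =>
      Finset.sum_congr rfl fun b _ => by ring
  rw [e2]
  exact Finset.sum_eq_zero fun a _ => Finset.sum_eq_zero fun b _ => by
    rw [h _ (hT a) _ (hT b), mul_zero]

lemma exists_comb_sub_mul_u_mem_fil {m : ℕ} (i : Fin n) (c : List (Fin n) → List (Fin n) → ℂ)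
    (h1 : ∀ v ∈ harmAt m i, ∀ w ∈ harm (Fin n) m, bil m c v w = 0)
    (h2 : ∀ v ∈ harm (Fin n) m, ∀ w ∈ harmAt m i, bil m c v w = 0) :
    ∃ y, comb n m c - y * ASu 0 i i ∈ fil n m := by
  rcases m with _ | m
  · refine ⟨0, ?_⟩
    rw [zero_mul, sub_zero]
    refine comb_mem_fil c fun v hv w hw => h1 v (mem_harmAt.2 ⟨hv, ?_⟩) w hw
    ext w
    exact mem_harm_zero.1 hv _ (by simp)
  · obtain ⟨s, hs⟩ := exists_linear_section (slice i) (harm (Fin n) (m + 1))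
    obtain ⟨d, hd⟩ := exists_bil_eq m ((bil (m + 1) c).compl₁₂ s s)
    let d' : List (Fin n) → List (Fin n) → ℂ
      | [], _ => 0
      | k :: a, b => if k = i then glue (Pi.single i (d a)) b else 0
    have hcomb : comb n (m + 1) d' = comb n m d * ASu 0 i i := by
      rw [comb_apply, comb_apply, sum_words_succ, Finset.sum_eq_single i]
      · rw [Finset.sum_mul]
        refine Finset.sum_congr rfl fun a _ => ?_
        rw [sum_words_succ, Finset.sum_eq_single i, Finset.sum_mul]
        · exact Finset.sum_congr rfl fun b _ => by simp [d', glue]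
        · intro k _ hk
          exact Finset.sum_eq_zero fun b _ => by simp [d', glue, hk]
        · simp
      · intro k _ hk
        exact Finset.sum_eq_zero fun a _ => Finset.sum_eq_zero fun b _ => by simp [d', hk]
      · simp
    have hbil : ∀ v w, bil (m + 1) d' v w = bil m d (slice i v) (slice i w) := by
      intro v w
      rw [bil_apply, bil_apply, sum_words_succ, Finset.sum_eq_single i]
      · refine Finset.sum_congr rfl fun a _ => ?_
        rw [sum_words_succ, Finset.sum_eq_single i]
        · exact Finset.sum_congr rfl fun b _ => by simp [d', glue]
        · intro k _ hk
          exact Finset.sum_eq_zero fun b _ => by simp [d', glue, hk]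
        · simp
      · intro k _ hk
        exact Finset.sum_eq_zero fun a _ => Finset.sum_eq_zero fun b _ => by simp [d', hk]
      · simp
    refine ⟨comb n m d, ?_⟩
    rw [← hcomb, ← map_sub]
    refine comb_mem_fil _ fun v hv w hw => ?_
    obtain ⟨hv1, hv2⟩ := hs v hv
    obtain ⟨hw1, hw2⟩ := hs w hw
    rw [bil_sub, hbil, hd (slice i v) (homog_cons (harm_le_homog _ hv) i) (slice i w)
      (homog_cons (harm_le_homog _ hw) i), LinearMap.compl₁₂_apply]
    have e1 := h1 (v - s (slice i v)) (mem_harmAt.2 ⟨Submodule.sub_mem _ hv hv1, by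
      rw [map_sub, hv2, sub_self]⟩) w hw
    have e2 := h2 (s (slice i v)) hv1 (w - s (slice i w))
      (mem_harmAt.2 ⟨Submodule.sub_mem _ hw hw1, by rw [map_sub, hw2, sub_self]⟩)
    rw [map_sub, LinearMap.sub_apply, sub_eq_zero] at e1
    rw [map_sub, sub_eq_zero] at e2
    rw [e1, e2, sub_self]

end Filtration

lemma bil_eq_zero_of_mul_u_eq_zero (hn : 4 ≤ n) {m : ℕ} {z : ASAlg n 0}
    {c : List (Fin n) → List (Fin n) → ℂ}
    (hz : z - comb n m c ∈ fil n m) {i j : Fin n} (h : z * ASu 0 i j = 0)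
    {v w : List (Fin n) → ℂ} (hv : v ∈ harmAt m i) (hw : w ∈ harmAt m j) : bil m c v w = 0 := by
  obtain ⟨V, hV, rfl⟩ := exists_slice_eq (by simpa using hn) m hv
  obtain ⟨W, hW, rfl⟩ := exists_slice_eq (by simpa using hn) m hw
  obtain ⟨φ, h1, h2⟩ := exists_functional hV hW
  have h3 : φ ((z - comb n m c) * ASu 0 i j) = 0 := by
    have : fil n (m + 1) ≤ LinearMap.ker φ := by
      refine Submodule.span_le.2 ?_
      rintro x ⟨a, b, hab, ha, rfl⟩
      exact h1 a b hab ha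
    exact this (mul_u_mem_fil hz i j)
  rw [sub_mul, h, zero_sub, map_neg, neg_eq_zero, comb_apply, Finset.sum_mul, map_sum] at h3
  rw [← h3, bil_apply]
  refine Finset.sum_congr rfl fun a ha => ?_
  rw [Finset.sum_mul, map_sum]
  refine Finset.sum_congr rfl fun b hb => ?_
  rw [smul_mul_assoc, map_smul, ← mon_cons, h2 _ _ (by simpa using ha) (by simpa using hb)]
  rfl

/-- An element annihilated by all off-diagonal generators vanishes. -/
lemma eq_zero_of_forall_mul_u_eq_zero (hn : 4 ≤ n) (a : ASAlg n 0)
    (h : ∀ i j, i ≠ j → a * ASu 0 i j = 0) : a = 0 := by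
  have hc : 4 ≤ Fintype.card (Fin n) := by simpa using hn
  obtain ⟨m, hm⟩ := exists_mem_fil a
  induction m with
  | zero => simpa [fil_zero] using hm
  | succ m ih =>
    obtain ⟨c, hz⟩ := exists_comb_of_mem_fil_succ hm
    refine ih ?_
    have hi : ∀ i, ∀ v ∈ harmAt m i, ∀ w ∈ harm (Fin n) m, bil m c v w = 0 := by
      intro i v hv w hw
      obtain ⟨l, l', h1, h2, -, h4, -⟩ := exists_two_avoid hc i i
      obtain ⟨x, hx, y, hy, rfl⟩ := exists_add_of_mem_harm hc m h1 hw
      rw [map_add, bil_eq_zero_of_mul_u_eq_zero hn hz (h i l h2.symm) hv hx,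
        bil_eq_zero_of_mul_u_eq_zero hn hz (h i l' h4.symm) hv hy, add_zero]
    have := Submodule.add_mem _ hz (comb_mem_fil c fun v hv w hw => by
      obtain ⟨x, hx, y, hy, rfl⟩ := exists_add_of_mem_harm hc m
        (i := ⟨0, by omega⟩) (j := ⟨1, by omega⟩) (by simp) hv
      rw [map_add, LinearMap.add_apply, hi _ x hx w hw, hi _ y hy w hw, add_zero])
    simpa using this

lemma exists_eq_add_mul_u (hn : 4 ≤ n) (z : Fin n → ASAlg n 0)
    (h : ∀ i j, i ≠ j → (z j - z i) * ASu 0 i j = 0) :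
    ∃ (a : ASAlg n 0) (y : Fin n → ASAlg n 0), ∀ j, z j = a + y j * ASu 0 j j := by
  have hcard : 4 ≤ Fintype.card (Fin n) := by simpa using hn
  obtain ⟨m, hm⟩ : ∃ m, ∀ i, z i ∈ fil n m := by
    choose k hk using fun i => exists_mem_fil (z i)
    exact ⟨Finset.univ.sup k, fun i => fil_mono (Finset.le_sup (Finset.mem_univ i)) (hk i)⟩
  induction m generalizing z with
  | zero => exact ⟨0, 0, fun j => by simpa [fil_zero] using hm j⟩
  | succ m ih =>
    choose c hc using fun i => exists_comb_of_mem_fil_succ (hm i)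
    have hcompat : ∀ i j, i ≠ j → ∀ v ∈ harmAt m i, ∀ w ∈ harmAt m j,
        bil m (c i) v w = bil m (c j) v w := by
      intro i j hij v hv w hw
      refine (sub_eq_zero.1 ?_).symm
      rw [← bil_sub]
      refine bil_eq_zero_of_mul_u_eq_zero hn (z := z j - z i) ?_ (h i j hij) hv hw
      rw [map_sub, sub_sub_sub_comm]
      exact Submodule.sub_mem _ (hc j) (hc i)
    let o : Fin n := ⟨0, by omega⟩
    let o' : Fin n := ⟨1, by omega⟩
    have ho : o ≠ o' := by simp [o, o']
    obtain ⟨l, hl⟩ := exists_linear_splitting (harmAt m o) (harmAt m o')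
    have hl' : ∀ v ∈ harm (Fin n) m, l v ∈ harmAt m o ∧ v - l v ∈ harmAt m o' := by
      intro v hv
      obtain ⟨x, hx, y, hy, rfl⟩ := exists_add_of_mem_harm hcard m ho hv
      exact hl _ (Submodule.add_mem_sup hx hy)
    obtain ⟨d, hd⟩ := exists_bil_eq m
      ((bil m (c o)).comp l + (bil m (c o')).comp (LinearMap.id - l))
    have hright : ∀ i, ∀ v ∈ harm (Fin n) m, ∀ w ∈ harmAt m i,
        bil m d v w = bil m (c i) v w := by
      intro i v hv w hw
      rw [hd v (harm_le_homog m hv) w (harm_le_homog m (mem_harmAt.1 hw).1)]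
      obtain ⟨h1, h2⟩ := hl' v hv
      have e1 : bil m (c o) (l v) w = bil m (c i) (l v) w := by
        by_cases hi : o = i
        · rw [hi]
        · exact hcompat _ _ hi _ h1 _ hw
      have e2 : bil m (c o') (v - l v) w = bil m (c i) (v - l v) w := by
        by_cases hi : o' = i
        · rw [hi]
        · exact hcompat _ _ hi _ h2 _ hw
      rw [LinearMap.add_apply, LinearMap.comp_apply, LinearMap.comp_apply, LinearMap.add_apply,
        LinearMap.sub_apply, LinearMap.id_apply, e1, e2, ← LinearMap.add_apply, ← map_add,
        add_sub_cancel]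
    have hleft : ∀ i, ∀ v ∈ harmAt m i, ∀ w ∈ harm (Fin n) m,
        bil m d v w = bil m (c i) v w := by
      intro i v hv w hw
      obtain ⟨k, k', h1, h2, -, h4, -⟩ := exists_two_avoid hcard i i
      obtain ⟨x, hx, y, hy, rfl⟩ := exists_add_of_mem_harm hcard m h1 hw
      rw [map_add, map_add, hright k v (mem_harmAt.1 hv).1 x hx,
        hright k' v (mem_harmAt.1 hv).1 y hy, hcompat i k h2.symm v hv x hx,
        hcompat i k' h4.symm v hv y hy]
    choose y hy using fun i => exists_comb_sub_mul_u_mem_fil i (c i - d)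
      (fun v hv w hw => by rw [bil_sub, hleft i v hv w hw, sub_self])
      (fun v hv w hw => by rw [bil_sub, hright i v hv w hw, sub_self])
    obtain ⟨a', y', h'⟩ := ih (fun i => z i - comb n m d - y i * ASu 0 i i) (fun i j hij => by
        have e : (z j - comb n m d - y j * ASu 0 j j - (z i - comb n m d - y i * ASu 0 i i)) =
          (z j - z i) - y j * ASu 0 j j + y i * ASu 0 i i := by abel
        rw [e, add_mul, sub_mul, h i j hij, mul_assoc, mul_assoc, u_mul_u_col, u_mul_u_row,
          if_neg hij.symm, if_neg hij]
        simp) (fun i => by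
        have := Submodule.add_mem _ (hc i) (hy i)
        rw [map_sub] at this
        convert this using 1
        abel)
    refine ⟨comb n m d + a', fun j => y j + y' j, fun j => ?_⟩
    rw [add_mul, ← sub_eq_zero]
    have := sub_eq_zero.2 (h' j)
    rw [← this]
    abel

variable (n) in
/-- The off-diagonal positions of an `n × n` matrix. -/
abbrev OffDiag := {p : Fin n × Fin n // p.1 ≠ p.2}

/-- The off-diagonal generators. -/
noncomputable def offu (p : OffDiag n) : ASAlg n 0 := ASu 0 p.1.1 p.1.2

variable (n) in
/-- The map `(z_j)_j ↦ ((z_j - z_i) u_{ij})_{i ≠ j}`. -/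
noncomputable def diffu : (Fin n → ASAlg n 0) →ₗ[ASAlg n 0] (OffDiag n → ASAlg n 0) where
  toFun z p := (z p.1.2 - z p.1.1) * offu p
  map_add' z z' := by ext p; simp [sub_mul, add_mul]; abel
  map_smul' a z := by ext p; simp [mul_assoc, ← mul_sub]

lemma diffu_apply (z : Fin n → ASAlg n 0) (p : OffDiag n) :
    diffu n z p = (z p.1.2 - z p.1.1) * offu p := rfl

variable (n) in
/-- The map `(y_{ij})_{i ≠ j} ↦ ∑ y_{ij} u_{ij}`. -/
noncomputable def sumu : (OffDiag n → ASAlg n 0) →ₗ[ASAlg n 0] ASAlg n 0 where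
  toFun y := ∑ p, y p * offu p
  map_add' y y' := by simp [add_mul, Finset.sum_add_distrib]
  map_smul' a y := by simp [mul_assoc, Finset.mul_sum]

lemma sumu_apply (y : OffDiag n → ASAlg n 0) : sumu n y = ∑ p, y p * offu p := rfl

lemma mul_offu_mem_range (a : ASAlg n 0) (p : OffDiag n) :
    a * offu p ∈ LinearMap.range (sumu n) := by
  classical
  refine ⟨Pi.single p a, ?_⟩
  rw [sumu_apply, Finset.sum_eq_single p]
  · simp
  · intro q _ hq; simp [hq]
  · simp

lemma sub_counit_mem_range (a : ASAlg n 0) :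
    a - algebraMap ℂ _ (ASeps n 0 a) ∈ LinearMap.range (sumu n) := by
  let S : Submodule ℂ (ASAlg n 0) :=
    { carrier := {a | a - algebraMap ℂ _ (ASeps n 0 a) ∈ LinearMap.range (sumu n)}
      zero_mem' := ⟨0, by simp⟩
      add_mem' := fun {a b} ha hb => by
        have := Submodule.add_mem (LinearMap.range (sumu n)) ha hb
        simp only [Set.mem_ofPred_eq, map_add]
        rwa [add_sub_add_comm]
      smul_mem' := fun c a ha => by
        have := Submodule.smul_mem (LinearMap.range (sumu n)) (algebraMap ℂ (ASAlg n 0) c) ha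
        simp only [Set.mem_ofPred_eq, map_smul, smul_eq_mul, map_mul]
        rw [smul_eq_mul, mul_sub] at this
        rwa [Algebra.smul_def] }
  refine mem_of_mul_u_mem S ⟨0, by simp⟩ (fun x hx i j => ?_) a
  change x * ASu 0 i j - algebraMap ℂ _ (ASeps n 0 (x * ASu 0 i j)) ∈ LinearMap.range (sumu n)
  rw [map_mul, ASeps_u]
  by_cases hij : i = j
  · subst hij
    have e : x * ASu 0 i i = x - ∑ k ∈ Finset.univ.erase i, x * ASu 0 i k := by
      rw [eq_sub_iff_add_eq, Finset.add_sum_erase _ (fun k => x * ASu 0 i k) (Finset.mem_univ i),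
        ← Finset.mul_sum,
        sum_u_row, mul_one]
    rw [e, if_pos rfl, mul_one, sub_right_comm]
    refine Submodule.sub_mem _ hx (Submodule.sum_mem _ fun k hk => ?_)
    exact mul_offu_mem_range x ⟨(i, k), (Finset.ne_of_mem_erase hk).symm⟩
  · rw [if_neg hij, mul_zero, map_zero, sub_zero]
    exact mul_offu_mem_range x ⟨(i, j), hij⟩

lemma exists_sumu_eq {a : ASAlg n 0} (ha : ASeps n 0 a = 0) : ∃ y, sumu n y = a := by
  have := sub_counit_mem_range a
  rwa [ha, map_zero, sub_zero] at this

/-- Elements `D i j` of a module behaving like the images of the generators under a derivation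
into a module with trivial right action extend to all of the algebra. -/
lemma exists_derivation {Q : Type*} [AddCommGroup Q] [Module (ASAlg n 0) Q] [Module ℂ Q]
    [IsScalarTower ℂ (ASAlg n 0) Q] (D : Fin n → Fin n → Q)
    (hrow : ∀ i, ∑ j, D i j = 0) (hcol : ∀ i, ∑ j, D j i = 0)
    (hu : ∀ i j, i ≠ j → ∃ e : Q, D i j = ASu 0 i j • e) :
    ∃ d : ASAlg n 0 →ₗ[ℂ] Q, ∀ x i j, i ≠ j → d (x * ASu 0 i j) = x • D i j := by
  have h1 : ∀ i j k, i ≠ k → ASu (0 : Matrix (Fin n) (Fin n) ℂ) i j • D i k =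
      if j = k then D i j else 0 := by
    intro i j k hik
    obtain ⟨e, he⟩ := hu i k hik
    rw [he, smul_smul, u_mul_u_row]
    split_ifs with h
    · rw [h, ← he]
    · rw [zero_smul]
  have h2 : ∀ i j k, k ≠ i → ASu (0 : Matrix (Fin n) (Fin n) ℂ) j i • D k i =
      if j = k then D j i else 0 := by
    intro i j k hik
    obtain ⟨e, he⟩ := hu k i hik
    rw [he, smul_smul, u_mul_u_col]
    split_ifs with h
    · rw [h, ← he]
    · rw [zero_smul]
  have h3 : ∀ i j, ASu (0 : Matrix (Fin n) (Fin n) ℂ) i j • D i i =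
      if j = i then 0 else -D i j := by
    intro i j
    have : D i i = -∑ k ∈ Finset.univ.erase i, D i k := by
      rw [eq_neg_iff_add_eq_zero, Finset.add_sum_erase _ _ (Finset.mem_univ i), hrow]
    rw [this, smul_neg, Finset.smul_sum,
      Finset.sum_congr rfl fun k hk => h1 i j k (Finset.ne_of_mem_erase hk).symm,
      Finset.sum_ite_eq]
    by_cases h : j = i <;> simp [h]
  have h4 : ∀ i j, ASu (0 : Matrix (Fin n) (Fin n) ℂ) j i • D i i =
      if j = i then 0 else -D j i := by
    intro i j
    have : D i i = -∑ k ∈ Finset.univ.erase i, D k i := by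
      rw [eq_neg_iff_add_eq_zero, Finset.add_sum_erase _ (fun k => D k i) (Finset.mem_univ i),
        hcol]
    rw [this, smul_neg, Finset.smul_sum,
      Finset.sum_congr rfl fun k hk => h2 i j k (Finset.ne_of_mem_erase hk),
      Finset.sum_ite_eq]
    by_cases h : j = i <;> simp [h]
  let U : Fin n → Fin n → Module.End ℂ (Q × ℂ) := fun i j =>
    LinearMap.prod
      (LinearMap.coprod (Module.toModuleEnd ℂ (S := ASAlg n 0) Q (ASu 0 i j))
        (LinearMap.toSpanSingleton ℂ Q (D i j)))
      ((if i = j then (1 : ℂ) else 0) • LinearMap.snd ℂ Q ℂ)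
  have hU : ∀ i j q r, U i j (q, r) = (ASu 0 i j • q + r • D i j, (if i = j then 1 else 0) * r) :=
    fun i j q r => rfl
  obtain ⟨F, hF⟩ : ∃ F : ASAlg n 0 →ₐ[ℂ] Module.End ℂ (Q × ℂ), ∀ i j, F (ASu 0 i j) = U i j := by
    refine exists_lift U ?_ ?_ ?_ ?_
    · intro i j k
      have key : ASu (0 : Matrix (Fin n) (Fin n) ℂ) i j • D i k + (if i = k then D i j else 0) =
          if j = k then D i j else 0 := by
        by_cases hik : i = k
        · subst hik
          rw [h3]
          by_cases h : j = i <;> simp [h]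
        · rw [h1 i j k hik, if_neg hik, add_zero]
      apply LinearMap.ext
      rintro ⟨q, r⟩
      rw [Module.End.mul_apply, hU, hU, smul_add, smul_smul, u_mul_u_row]
      have e : ASu (0 : Matrix (Fin n) (Fin n) ℂ) i j • r • D i k +
          ((if i = k then (1 : ℂ) else 0) * r) • D i j = r • if j = k then D i j else 0 := by
        rw [← key, smul_add, smul_algebra_smul_comm]
        split_ifs <;> simp
      rw [add_assoc, e]
      by_cases h : j = k
      · subst h
        simp only [if_true, hU]
        by_cases h : i = j <;> simp [h]
      · simp only [if_neg h, zero_smul, smul_zero, add_zero, LinearMap.zero_apply]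
        by_cases h' : i = j
        · have : i ≠ k := h' ▸ h
          simp [this]
        · simp [h']
    · intro i j k
      have key : ASu (0 : Matrix (Fin n) (Fin n) ℂ) j i • D k i + (if k = i then D j i else 0) =
          if j = k then D j i else 0 := by
        by_cases hik : k = i
        · subst hik
          rw [h4]
          by_cases h : j = k <;> simp [h]
        · rw [h2 i j k hik, if_neg hik, add_zero]
      apply LinearMap.ext
      rintro ⟨q, r⟩
      rw [Module.End.mul_apply, hU, hU, smul_add, smul_smul, u_mul_u_col]
      have e : ASu (0 : Matrix (Fin n) (Fin n) ℂ) j i • r • D k i +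
          ((if k = i then (1 : ℂ) else 0) * r) • D j i = r • if j = k then D j i else 0 := by
        rw [← key, smul_add, smul_algebra_smul_comm]
        split_ifs <;> simp
      rw [add_assoc, e]
      by_cases h : j = k
      · subst h
        simp only [if_true, hU]
        by_cases h : j = i <;> simp [h]
      · simp only [if_neg h, zero_smul, smul_zero, add_zero, LinearMap.zero_apply]
        by_cases h' : j = i
        · have : k ≠ i := fun h'' => h (h'.trans h''.symm)
          simp [this]
        · simp [h']
    · intro i
      apply LinearMap.ext
      rintro ⟨q, r⟩
      rw [LinearMap.sum_apply]
      simp only [hU]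
      rw [Prod.ext_iff]
      simp only [Prod.fst_sum, Prod.snd_sum, Finset.sum_add_distrib, ← Finset.sum_smul,
        ← Finset.smul_sum, sum_u_row, hrow]
      simp
    · intro i
      apply LinearMap.ext
      rintro ⟨q, r⟩
      rw [LinearMap.sum_apply]
      simp only [hU]
      rw [Prod.ext_iff]
      simp only [Prod.fst_sum, Prod.snd_sum, Finset.sum_add_distrib, ← Finset.sum_smul,
        ← Finset.smul_sum, sum_u_col, hcol]
      simp
  have hq : ∀ x q, F x (q, 0) = (x • q, 0) := by
    let R : Subalgebra ℂ (ASAlg n 0) :=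
      { carrier := {x | ∀ q, F x (q, 0) = (x • q, 0)}
        mul_mem' := fun {x y} hx hy q => by
          rw [map_mul, Module.End.mul_apply, hy, hx, smul_smul]
        add_mem' := fun {x y} hx hy q => by
          rw [map_add, LinearMap.add_apply, hy, hx, add_smul]; simp
        algebraMap_mem' := fun r q => by
          rw [AlgHom.commutes, Module.algebraMap_end_apply, algebraMap_smul]; simp }
    exact adjoin_eq_top R fun i j q => by rw [hF, hU]; simp
  refine ⟨LinearMap.fst ℂ Q ℂ ∘ₗ LinearMap.applyₗ ((0 : Q), (1 : ℂ)) ∘ₗ F.toLinearMap,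
    fun x i j hij => ?_⟩
  simp [map_mul, Module.End.mul_apply, hF, hU, hij, hq]

lemma exists_diffu_eq {y : OffDiag n → ASAlg n 0} (hy : sumu n y = 0) :
    ∃ z, ∀ p, diffu n z p = y p * offu p := by
  let D₀ : Fin n → Fin n → OffDiag n → ASAlg n 0 := fun i j p =>
    if i = j then (if p.1.1 = i then -offu p else 0)
    else if p.1.1 = i ∧ p.1.2 = j then offu p else 0
  let q := Submodule.mkQ (LinearMap.range (diffu n))
  obtain ⟨d, hd⟩ : ∃ d : ASAlg n 0 →ₗ[ℂ] (OffDiag n → ASAlg n 0) ⧸ LinearMap.range (diffu n),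
      ∀ x i j, i ≠ j → d (x * ASu 0 i j) = x • q (D₀ i j) := by
    refine exists_derivation (fun i j => q (D₀ i j)) (fun i => ?_) (fun i => ?_)
      fun i j hij => ?_
    · rw [← map_sum]
      have : ∑ j, D₀ i j = 0 := by
        ext p
        rw [Finset.sum_apply, ← Finset.add_sum_erase _ _ (Finset.mem_univ i),
          Finset.sum_congr rfl (g := fun j => if p.1.2 = j then
            (if p.1.1 = i then offu p else 0) else 0)]
        · rw [Finset.sum_ite_eq]
          have := p.2
          by_cases h : p.1.1 = i
          · subst h; simp [D₀, this.symm]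
          · simp [D₀, h]
        · intro j hj
          have := (Finset.ne_of_mem_erase hj).symm
          by_cases h : p.1.1 = i <;> simp [D₀, this, h]
      rw [this, map_zero]
    · rw [← map_sum]
      refine (Submodule.Quotient.mk_eq_zero _).2 ⟨Pi.single i 1, ?_⟩
      ext p
      rw [Finset.sum_apply, ← Finset.add_sum_erase _ _ (Finset.mem_univ i),
        Finset.sum_congr rfl (g := fun j => if p.1.1 = j then
          (if p.1.2 = i then offu p else 0) else 0), diffu_apply]
      · rw [Finset.sum_ite_eq]
        have := p.2
        by_cases h : p.1.1 = i
        · subst h; simp [D₀, this.symm]; exact neg_one_mul (offu p)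
        · by_cases h' : p.1.2 = i <;> simp [D₀, h, h']
      · intro j hj
        have := Finset.ne_of_mem_erase hj
        by_cases h : p.1.1 = j <;> simp [D₀, this, h]
    · refine ⟨q fun p => if p.1.1 = i ∧ p.1.2 = j then 1 else 0, ?_⟩
      rw [← map_smul]
      congr 1
      ext p
      by_cases h : p.1.1 = i ∧ p.1.2 = j
      · simp [D₀, h, hij, offu]
      · simp [D₀, h, hij]
  have h1 : q (fun p => y p * offu p) = 0 := by
    have h2 : (fun p => y p * offu p) = ∑ p : OffDiag n, y p • D₀ p.1.1 p.1.2 := by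
      ext r
      rw [Finset.sum_apply, Finset.sum_eq_single r]
      · simp [D₀, r.2]
      · intro p _ hp
        have : ¬ (r.1.1 = p.1.1 ∧ r.1.2 = p.1.2) := fun h =>
          hp (Subtype.ext (Prod.ext h.1.symm h.2.symm))
        simp [D₀, p.2, this]
      · simp
    have h3 := congrArg d hy
    rw [map_zero, sumu_apply, map_sum] at h3
    rw [h2, map_sum, ← h3]
    exact Finset.sum_congr rfl fun p _ => by rw [offu, hd _ _ _ p.2, map_smul]
  obtain ⟨z, hz⟩ := (Submodule.Quotient.mk_eq_zero _).1 h1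
  exact ⟨z, fun p => congrFun hz p⟩

end ASAlg

section Curry

variable (M : Type*) [AddCommGroup M] [Module ℂ M]

/-- Linear forms as multilinear maps in one variable. -/
noncomputable def uncurry₁ :
    (M →ₗ[ℂ] ℂ) ≃ₗ[ℂ] MultilinearMap ℂ (fun _ : Fin 1 => M) ℂ :=
  MultilinearMap.ofSubsingletonₗ ℂ ℂ M ℂ 0

/-- Curried bilinear maps as multilinear maps in two variables. -/
noncomputable def uncurry₂ :
    (M →ₗ[ℂ] M →ₗ[ℂ] ℂ) ≃ₗ[ℂ] MultilinearMap ℂ (fun _ : Fin 2 => M) ℂ :=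
  (LinearEquiv.congrRight (uncurry₁ M)).trans
    (multilinearCurryLeftEquiv ℂ (fun _ : Fin 2 => M) ℂ).symm

/-- Curried trilinear maps as multilinear maps in three variables. -/
noncomputable def uncurry₃ :
    (M →ₗ[ℂ] M →ₗ[ℂ] M →ₗ[ℂ] ℂ) ≃ₗ[ℂ] MultilinearMap ℂ (fun _ : Fin 3 => M) ℂ :=
  (LinearEquiv.congrRight (uncurry₂ M)).trans
    (multilinearCurryLeftEquiv ℂ (fun _ : Fin 3 => M) ℂ).symm

variable {M}

lemma uncurry₂_apply (g : M →ₗ[ℂ] M →ₗ[ℂ] ℂ) (a : Fin 2 → M) :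
    uncurry₂ M g a = g (a 0) (a 1) := rfl

lemma uncurry₃_apply (f : M →ₗ[ℂ] M →ₗ[ℂ] M →ₗ[ℂ] ℂ) (a : Fin 3 → M) :
    uncurry₃ M f a = f (a 0) (a 1) (a 2) := rfl

end Curry

section Cochains

variable {A : Type*} [Ring A] [Algebra ℂ A] (ε : A →ₐ[ℂ] ℂ)

/-- The Hochschild differential of a curried bilinear map. -/
def bilinDiff (g : A →ₗ[ℂ] A →ₗ[ℂ] ℂ) (a b c : A) : ℂ :=
  ε a * g b c - g (a * b) c + g a (b * c) - g a b * ε c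

/-- The Hochschild differential of a curried trilinear map. -/
def trilinDiff (f : A →ₗ[ℂ] A →ₗ[ℂ] A →ₗ[ℂ] ℂ) (a b c d : A) : ℂ :=
  ε a * f b c d - f (a * b) c d + f a (b * c) d - f a b (c * d) + f a b c * ε d

lemma hdiff_uncurry₂ (g : A →ₗ[ℂ] A →ₗ[ℂ] ℂ) (a : Fin 3 → A) :
    hdiff ε 2 (uncurry₂ A g) a = bilinDiff ε g (a 0) (a 1) (a 2) := by
  simp [hdiff, bilinDiff, uncurry₂_apply, Fin.sum_univ_two]
  ring

lemma hdiff_uncurry₃ (f : A →ₗ[ℂ] A →ₗ[ℂ] A →ₗ[ℂ] ℂ) (a : Fin 4 → A) :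
    hdiff ε 3 (uncurry₃ A f) a = trilinDiff ε f (a 0) (a 1) (a 2) (a 3) := by
  simp [hdiff, trilinDiff, uncurry₃_apply, Fin.sum_univ_three]
  ring

lemma trilinDiff_sub_smul (f f' : A →ₗ[ℂ] A →ₗ[ℂ] A →ₗ[ℂ] ℂ) (s : ℂ) (a b c d : A) :
    trilinDiff ε (f - s • f') a b c d = trilinDiff ε f a b c d - s * trilinDiff ε f' a b c d := by
  simp [trilinDiff]
  ring

/-- A cocycle which agrees with a coboundary whenever its last argument lies in the augmentation
ideal is a coboundary. -/
lemma exists_bilinDiff_eq_of_ker {f : A →ₗ[ℂ] A →ₗ[ℂ] A →ₗ[ℂ] ℂ}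
    (hf : ∀ a b c d, trilinDiff ε f a b c d = 0) (g : A →ₗ[ℂ] A →ₗ[ℂ] ℂ)
    (hg : ∀ a b c, ε c = 0 → f a b c = bilinDiff ε g a b c) :
    ∃ g' : A →ₗ[ℂ] A →ₗ[ℂ] ℂ, ∀ a b c, f a b c = bilinDiff ε g' a b c := by
  let φ : A →ₗ[ℂ] A →ₗ[ℂ] ℂ := LinearMap.mk₂ ℂ
    (fun a b => f a b 1 - ε a * g b 1 + g (a * b) 1)
    (fun a a' b => by simp [add_mul]; ring) (fun c a b => by simp; ring)
    (fun a b b' => by simp [mul_add]; ring) (fun c a b => by simp; ring)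
  have hφ : ∀ a b, φ a b = f a b 1 - ε a * g b 1 + g (a * b) 1 := fun a b => rfl
  refine ⟨g - φ, fun a b c => ?_⟩
  have h1 := hf a b c 1
  have h2 := hg a b (c - algebraMap ℂ A (ε c)) (by simp)
  simp only [Algebra.algebraMap_eq_smul_one, map_sub, bilinDiff, map_smul, smul_eq_mul, mul_sub,
    mul_smul_comm, mul_one, map_one, sub_self, mul_zero, sub_zero] at h2
  simp only [trilinDiff, mul_one, map_one] at h1
  simp only [bilinDiff, LinearMap.sub_apply, hφ, map_mul, mul_assoc]
  linear_combination h2 + h1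

end Cochains

namespace ASAlg

variable {n : ℕ}

lemma exists_factor {E F G : Type*} [AddCommGroup E] [Module ℂ E] [AddCommGroup F]
    [Module ℂ F] [AddCommGroup G] [Module ℂ G] (f : E →ₗ[ℂ] F) (g : E →ₗ[ℂ] G)
    (h : ∀ x, g x = 0 → f x = 0) : ∃ k : G →ₗ[ℂ] F, ∀ x, k (g x) = f x := by
  obtain ⟨s, hs⟩ := exists_linear_section g ⊤
  refine ⟨f ∘ₗ s, fun x => ?_⟩
  have := h (s (g x) - x) (by rw [map_sub, (hs x trivial).2, sub_self])
  rwa [map_sub, sub_eq_zero] at this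

lemma sum_apply_snd_offu (B : Fin n → ASAlg n 0 →ₗ[ℂ] ℂ) :
    ∑ p : OffDiag n, B p.1.2 (offu p) = ∑ j, B j (1 - ASu 0 j j) := by
  classical
  have h := Finset.sum_subtype (F := inferInstance) (p := fun p : Fin n × Fin n => p.1 ≠ p.2)
    (Finset.univ.filter fun p => p.1 ≠ p.2) (by simp) (fun p => B p.2 (ASu 0 p.1 p.2))
  refine h.symm.trans ?_
  rw [Finset.sum_filter, Fintype.sum_prod_type_right]
  refine Finset.sum_congr rfl fun j _ => ?_
  rw [← Finset.sum_filter]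
  simp only []
  rw [← map_sum, Finset.filter_ne',
    ← sum_u_col j, ← Finset.add_sum_erase _ _ (Finset.mem_univ j), add_sub_cancel_left]

lemma sum_apply_fst_offu (B : Fin n → ASAlg n 0 →ₗ[ℂ] ℂ) :
    ∑ p : OffDiag n, B p.1.1 (offu p) = ∑ j, B j (1 - ASu 0 j j) := by
  classical
  have h := Finset.sum_subtype (F := inferInstance) (p := fun p : Fin n × Fin n => p.1 ≠ p.2)
    (Finset.univ.filter fun p => p.1 ≠ p.2) (by simp) (fun p => B p.1 (ASu 0 p.1 p.2))
  refine h.symm.trans ?_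
  rw [Finset.sum_filter, Fintype.sum_prod_type]
  refine Finset.sum_congr rfl fun j _ => ?_
  rw [← Finset.sum_filter]
  simp only []
  rw [← map_sum, Finset.filter_ne,
    ← sum_u_row j, ← Finset.add_sum_erase _ _ (Finset.mem_univ j), add_sub_cancel_left]

lemma offu_mul_self (p : OffDiag n) : offu p * offu p = offu p := by
  rw [offu, u_mul_u_row, if_pos rfl]

lemma fst_mul_offu (p : OffDiag n) : ASu 0 p.1.1 p.1.1 * offu p = 0 := by
  rw [offu, u_mul_u_row, if_neg p.2]

lemma snd_mul_offu (p : OffDiag n) : ASu 0 p.1.2 p.1.2 * offu p = 0 := by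
  rw [offu, u_mul_u_col, if_neg p.2.symm]

lemma counit_offu (p : OffDiag n) : ASeps n 0 (offu p) = 0 := by
  rw [offu, ASeps_u, if_neg p.2]

lemma counit_sumu (y : OffDiag n → ASAlg n 0) : ASeps n 0 (sumu n y) = 0 := by
  simp [sumu_apply, counit_offu]

/-- The linear form on trilinear maps detecting the class of a cocycle. -/
noncomputable def charge (f : ASAlg n 0 →ₗ[ℂ] ASAlg n 0 →ₗ[ℂ] ASAlg n 0 →ₗ[ℂ] ℂ) : ℂ :=
  ∑ p : OffDiag n, f (ASu 0 p.1.2 p.1.2 - ASu 0 p.1.1 p.1.1) (offu p) (offu p)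

lemma charge_sub_smul (f f' : ASAlg n 0 →ₗ[ℂ] ASAlg n 0 →ₗ[ℂ] ASAlg n 0 →ₗ[ℂ] ℂ) (s : ℂ) :
    charge (f - s • f') = charge f - s * charge f' := by
  simp only [charge, LinearMap.sub_apply, LinearMap.smul_apply, smul_eq_mul, Finset.sum_sub_distrib,
    Finset.mul_sum]

lemma charge_eq_zero {f : ASAlg n 0 →ₗ[ℂ] ASAlg n 0 →ₗ[ℂ] ASAlg n 0 →ₗ[ℂ] ℂ}
    (g : ASAlg n 0 →ₗ[ℂ] ASAlg n 0 →ₗ[ℂ] ℂ)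
    (h : ∀ a b c, f a b c = bilinDiff (ASeps n 0) g a b c) : charge f = 0 := by
  have h1 : ∀ p : OffDiag n, f (ASu 0 p.1.2 p.1.2 - ASu 0 p.1.1 p.1.1) (offu p) (offu p) =
      g (ASu 0 p.1.2 p.1.2) (offu p) - g (ASu 0 p.1.1 p.1.1) (offu p) := fun p => by
    rw [h, bilinDiff, offu_mul_self, sub_mul, snd_mul_offu, fst_mul_offu, counit_offu, map_sub,
      ASeps_u, ASeps_u]
    simp
  rw [charge, Finset.sum_congr rfl fun p _ => h1 p, Finset.sum_sub_distrib,
    sum_apply_snd_offu fun j => g (ASu 0 j j), sum_apply_fst_offu fun j => g (ASu 0 j j), sub_self]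

variable (n) in
/-- The map `(y_{ij})_{i ≠ j} ↦ (y_{ij} u_{ij})_{i ≠ j}`. -/
noncomputable def mulOffu : (OffDiag n → ASAlg n 0) →ₗ[ASAlg n 0] (OffDiag n → ASAlg n 0) where
  toFun y p := y p * offu p
  map_add' y y' := by ext p; simp [add_mul]
  map_smul' a y := by ext p; simp [mul_assoc]

lemma mulOffu_apply (y : OffDiag n → ASAlg n 0) (p : OffDiag n) :
    mulOffu n y p = y p * offu p := rfl

/-- A linear map on `A^{OffDiag}` vanishing on the kernel of `sumu` factors through `sumu`. -/
lemma exists_factor_sumu {F : Type*} [AddCommGroup F] [Module ℂ F]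
    (f : (OffDiag n → ASAlg n 0) →ₗ[ℂ] F) (h : ∀ y, sumu n y = 0 → f y = 0) :
    ∃ k : ASAlg n 0 →ₗ[ℂ] F, ∀ y, k (sumu n y) = f y :=
  exists_factor f ((sumu n).restrictScalars ℂ) h

/-- A linear map on `A^n` vanishing on the kernel of `diffu` factors through `diffu`. -/
lemma exists_factor_diffu (hn : 4 ≤ n) {F : Type*} [AddCommGroup F] [Module ℂ F]
    (f : (Fin n → ASAlg n 0) →ₗ[ℂ] F)
    (h : ∀ (a : ASAlg n 0) (y : Fin n → ASAlg n 0), f (fun j => a + y j * ASu 0 j j) = 0) :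
    ∃ k : (OffDiag n → ASAlg n 0) →ₗ[ℂ] F, ∀ z, k (diffu n z) = f z := by
  refine exists_factor f ((diffu n).restrictScalars ℂ) fun z hz => ?_
  obtain ⟨a, y, hy⟩ := exists_eq_add_mul_u hn z fun i j hij => congrFun hz ⟨(i, j), hij⟩
  rw [funext hy]
  exact h a y

/-- A cocycle of charge zero is a coboundary. -/
lemma exists_bilinDiff_eq (hn : 4 ≤ n)
    {f : ASAlg n 0 →ₗ[ℂ] ASAlg n 0 →ₗ[ℂ] ASAlg n 0 →ₗ[ℂ] ℂ}
    (hf : ∀ a b c d, trilinDiff (ASeps n 0) f a b c d = 0) (h0 : charge f = 0) :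
    ∃ g : ASAlg n 0 →ₗ[ℂ] ASAlg n 0 →ₗ[ℂ] ℂ, ∀ a b c, f a b c = bilinDiff (ASeps n 0) g a b c := by
  let h : (OffDiag n → ASAlg n 0) →ₗ[ℂ] ASAlg n 0 →ₗ[ℂ] ℂ := LinearMap.mk₂ ℂ
    (fun y a => ∑ p, f a (y p * offu p) (offu p))
    (fun y y' a => by simp [add_mul, Finset.sum_add_distrib])
    (fun c y a => by simp [Finset.mul_sum])
    (fun y a a' => by simp [Finset.sum_add_distrib])
    (fun c y a => by simp [Finset.mul_sum])
  have h_apply : ∀ y a, h y a = ∑ p, f a (y p * offu p) (offu p) := fun y a => rfl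
  let β : (Fin n → ASAlg n 0) → OffDiag n → ASAlg n 0 := fun z p =>
    z p.1.2 * (1 - ASu 0 p.1.2 p.1.2) - z p.1.1 * (1 - ASu 0 p.1.1 p.1.1)
  let k : (Fin n → ASAlg n 0) →ₗ[ℂ] ℂ :=
    { toFun z := -∑ p, f (β z p) (offu p) (offu p)
      map_add' z z' := by
        rw [← neg_add, ← Finset.sum_add_distrib]
        congr 1
        refine Finset.sum_congr rfl fun p _ => ?_
        rw [← LinearMap.add_apply, ← LinearMap.add_apply, ← map_add]
        congr 3
        simp only [β, Pi.add_apply, add_mul]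
        abel
      map_smul' c z := by
        rw [RingHom.id_apply, smul_neg, Finset.smul_sum]
        congr 1
        refine Finset.sum_congr rfl fun p _ => ?_
        rw [← LinearMap.smul_apply, ← LinearMap.smul_apply, ← map_smul]
        congr 3
        simp only [β, Pi.smul_apply, smul_mul_assoc, smul_sub] }
  have k_apply : ∀ z, k z = -∑ p, f (β z p) (offu p) (offu p) := fun z => rfl
  have hf_sumu : ∀ a b y, f a b (sumu n y) =
      ASeps n 0 a * h y b - h y (a * b) + h (b • y) a := by
    intro a b y
    simp only [h_apply, sumu_apply, map_sum, Finset.mul_sum]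
    rw [← Finset.sum_sub_distrib, ← Finset.sum_add_distrib]
    refine Finset.sum_congr rfl fun p _ => ?_
    have := hf a b (y p * offu p) (offu p)
    rw [trilinDiff, mul_assoc, offu_mul_self, counit_offu] at this
    rw [Pi.smul_apply, smul_eq_mul, mul_assoc]
    linear_combination -this
  have hR : ∀ a z, h (fun p => z p.1.2 - z p.1.1) a = ASeps n 0 a * k z - k (a • z) := by
    intro a z
    have h1 : ∑ p, f a (β z p) (offu p) = 0 := by
      simp only [β, map_sub, LinearMap.sub_apply, Finset.sum_sub_distrib]
      rw [sum_apply_snd_offu fun j => f a (z j * (1 - ASu 0 j j)),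
        sum_apply_fst_offu fun j => f a (z j * (1 - ASu 0 j j)), sub_self]
    have h2 : ∀ p : OffDiag n, f a ((z p.1.2 - z p.1.1) * offu p) (offu p) =
        f a (β z p) (offu p) - ASeps n 0 a * f (β z p) (offu p) (offu p) +
          f (β (a • z) p) (offu p) (offu p) := by
      intro p
      have h3 := hf a (β z p) (offu p) (offu p)
      have h4 : β z p * offu p = (z p.1.2 - z p.1.1) * offu p := by
        simp only [β, sub_mul, mul_assoc, one_mul, fst_mul_offu, snd_mul_offu, sub_zero]
      have h5 : β (a • z) p = a * β z p := by
        simp only [β, Pi.smul_apply, smul_eq_mul, mul_sub, mul_assoc]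
      rw [trilinDiff, offu_mul_self, counit_offu, h4] at h3
      rw [h5]
      linear_combination h3
    rw [h_apply, k_apply, k_apply, Finset.sum_congr rfl fun p _ => h2 p, Finset.sum_add_distrib,
      Finset.sum_sub_distrib, h1, ← Finset.mul_sum]
    ring
  have k_const : ∀ a, k (fun _ => a) = 0 := by
    intro a
    have h1 : k (fun _ => 1) = charge f := by
      rw [k_apply, charge, ← Finset.sum_neg_distrib]
      refine Finset.sum_congr rfl fun p _ => ?_
      simp [β]
    have h2 := hR a fun _ => 1
    have h3 : a • (fun _ : Fin n => (1 : ASAlg n 0)) = fun _ => a := by ext; simp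
    rw [h1, h0, h3, mul_zero, zero_sub] at h2
    simpa [h_apply] using h2.symm
  obtain ⟨κ, hκ⟩ := exists_factor_diffu hn k fun a y => by
    have : (fun j => a + y j * ASu 0 j j) = (fun _ => a) + fun j => y j * ASu 0 j j := rfl
    rw [this, map_add, k_const, zero_add, k_apply]
    simp [β, mul_assoc, mul_sub, u_mul_u_row]
  let h' : (OffDiag n → ASAlg n 0) →ₗ[ℂ] ASAlg n 0 →ₗ[ℂ] ℂ := LinearMap.mk₂ ℂ
    (fun y a => h y a - ASeps n 0 a * κ (mulOffu n y) + κ (mulOffu n (a • y)))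
    (fun y y' a => by simp; ring)
    (fun c y a => by simp [smul_comm a c, LinearMap.map_smul_of_tower]; ring)
    (fun y a a' => by simp [add_smul]; ring)
    (fun c y a => by simp [LinearMap.map_smul_of_tower]; ring)
  have h'_apply : ∀ y a, h' y a =
    h y a - ASeps n 0 a * κ (mulOffu n y) + κ (mulOffu n (a • y)) := fun y a => rfl
  obtain ⟨G, hG⟩ := exists_factor_sumu h' fun y hy => by
    obtain ⟨z, hz⟩ := exists_diffu_eq hy
    have hz' : mulOffu n y = diffu n z := funext fun p => (hz p).symm
    ext a
    have h1 : h y a = h (fun p => z p.1.2 - z p.1.1) a := by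
      simp only [h_apply, ← hz, diffu_apply]
    rw [h'_apply, h1, hR, map_smul (mulOffu n), hz', ← map_smul (diffu n), hκ, hκ]
    simp
  refine exists_bilinDiff_eq_of_ker _ hf G.flip fun a b c hc => ?_
  obtain ⟨y, rfl⟩ := exists_sumu_eq hc
  have hb : b * sumu n y = sumu n (b • y) := by rw [map_smul, smul_eq_mul]
  rw [hf_sumu, bilinDiff, counit_sumu, hb]
  simp only [LinearMap.flip_apply, hG, h'_apply, map_mul, smul_smul]
  ring

/-- There is a cocycle of charge one. -/
lemma exists_trilinDiff_eq_zero (hn : 4 ≤ n) :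
    ∃ f : ASAlg n 0 →ₗ[ℂ] ASAlg n 0 →ₗ[ℂ] ASAlg n 0 →ₗ[ℂ] ℂ,
      (∀ a b c d, trilinDiff (ASeps n 0) f a b c d = 0) ∧ charge f = 1 := by
  obtain ⟨k, hk⟩ : ∃ k : (Fin n → ASAlg n 0) →ₗ[ℂ] ℂ,
      ∀ (a : ASAlg n 0) (y : Fin n → ASAlg n 0),
        k (fun j => a + y j * ASu 0 j j) = ASeps n 0 a := by
    let T : (ASAlg n 0 × (Fin n → ASAlg n 0)) →ₗ[ℂ] (Fin n → ASAlg n 0) :=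
      { toFun x j := x.1 + x.2 j * ASu 0 j j
        map_add' x x' := by ext j; simp [add_mul]; abel
        map_smul' c x := by ext j; simp }
    obtain ⟨k, hk⟩ := exists_factor ((ASeps n 0).toLinearMap ∘ₗ LinearMap.fst ℂ _ _) T
      fun x hx => by
        have : x.1 = 0 := eq_zero_of_forall_mul_u_eq_zero hn _ fun i j hij => by
          have h1 : x.1 + x.2 j * ASu 0 j j = 0 := congrFun hx j
          have h2 := congrArg (· * ASu 0 i j) h1
          simpa only [add_mul, mul_assoc, u_mul_u_col, if_neg hij.symm, mul_zero, add_zero,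
            zero_mul] using h2
        simp [this]
    exact ⟨k, fun a y => hk (a, y)⟩
  have hk_diag : ∀ y : Fin n → ASAlg n 0, k (fun j => y j * ASu 0 j j) = 0 := fun y => by
    simpa using hk 0 y
  let K : (Fin n → ASAlg n 0) →ₗ[ℂ] ASAlg n 0 →ₗ[ℂ] ℂ := LinearMap.mk₂ ℂ
    (fun z a => ASeps n 0 a * k z - k (a • z))
    (fun z z' a => by simp; ring)
    (fun c z a => by simp [smul_comm a c]; ring)
    (fun z a a' => by simp [add_smul]; ring)
    (fun c z a => by simp; ring)
  have K_apply : ∀ z a, K z a = ASeps n 0 a * k z - k (a • z) := fun z a => rfl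
  obtain ⟨H, hH⟩ := exists_factor_diffu hn K fun a y => by
    ext b
    have : b • (fun j => a + y j * ASu 0 j j) = fun j => b * a + (b * y j) * ASu 0 j j := by
      ext j; simp [mul_add, mul_assoc]
    rw [K_apply, this, hk, hk (b * a) fun j => b * y j, map_mul, sub_self, LinearMap.zero_apply]
  let L : (OffDiag n → ASAlg n 0) →ₗ[ℂ] ASAlg n 0 →ₗ[ℂ] ASAlg n 0 →ₗ[ℂ] ℂ :=
    { toFun y := LinearMap.mk₂ ℂ (fun a b => ASeps n 0 a * H (mulOffu n y) b -
          H (mulOffu n y) (a * b) + H (mulOffu n (b • y)) a)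
        (fun a a' b => by simp [add_mul]; ring)
        (fun c a b => by simp; ring)
        (fun a b b' => by simp [mul_add, add_smul]; ring)
        (fun c a b => by simp [LinearMap.map_smul_of_tower]; ring)
      map_add' y y' := by ext a b; simp; ring
      map_smul' c y := by
        ext a b; simp [smul_comm _ c, LinearMap.map_smul_of_tower]; ring }
  have L_apply : ∀ y a b, L y a b = ASeps n 0 a * H (mulOffu n y) b -
    H (mulOffu n y) (a * b) + H (mulOffu n (b • y)) a := fun y a b => rfl
  obtain ⟨F, hF⟩ := exists_factor_sumu L fun y hy => by
    obtain ⟨z, hz⟩ := exists_diffu_eq hy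
    have hz' : mulOffu n y = diffu n z := funext fun p => (hz p).symm
    ext a b
    rw [L_apply, map_smul (mulOffu n), hz', ← map_smul (diffu n), hH, hH, K_apply, K_apply,
      K_apply, map_mul, smul_smul]
    simp
    ring
  let P : ASAlg n 0 →ₗ[ℂ] ASAlg n 0 :=
    LinearMap.id - (Algebra.linearMap ℂ (ASAlg n 0)) ∘ₗ (ASeps n 0).toLinearMap
  have P_sumu : ∀ y, P (sumu n y) = sumu n y := fun y => by simp [P, counit_sumu]
  have P_one : P 1 = 0 := by simp [P]
  let f : ASAlg n 0 →ₗ[ℂ] ASAlg n 0 →ₗ[ℂ] ASAlg n 0 →ₗ[ℂ] ℂ :=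
    LinearMap.mk₂ ℂ (fun a b => (F.flip a).flip b ∘ₗ P)
      (fun a a' b => by ext; simp) (fun c a b => by ext; simp)
      (fun a b b' => by ext; simp) (fun c a b => by ext; simp)
  have f_apply : ∀ a b c, f a b c = F (P c) a b := fun a b c => rfl
  have f_sumu : ∀ a b y, f a b (sumu n y) = L y a b := fun a b y => by
    rw [f_apply, P_sumu, hF]
  refine ⟨f, fun a b c d => ?_, ?_⟩
  · have hd : d = ASeps n 0 d • 1 + (d - algebraMap ℂ _ (ASeps n 0 d)) := by
      rw [Algebra.algebraMap_eq_smul_one]; abel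
    obtain ⟨y, hy⟩ := exists_sumu_eq (a := d - algebraMap ℂ _ (ASeps n 0 d)) (by simp)
    have h1 : ∀ a b c, trilinDiff (ASeps n 0) f a b c 1 = 0 := fun a b c => by
      simp [trilinDiff, f_apply, P_one]
    have h2 : ∀ a b c, trilinDiff (ASeps n 0) f a b c (sumu n y) = 0 := fun a b c => by
      have hc : c * sumu n y = sumu n (c • y) := by rw [map_smul, smul_eq_mul]
      rw [trilinDiff, hc, f_sumu, f_sumu, f_sumu, f_sumu, counit_sumu]
      simp only [L_apply, map_mul, smul_smul, mul_assoc]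
      ring
    have h3 := h1 a b c
    have h4 := h2 a b c
    rw [hd, ← hy]
    simp only [trilinDiff, mul_add, mul_smul_comm, map_add, map_smul, smul_eq_mul,
      map_one] at h3 h4 ⊢
    linear_combination ASeps n 0 d * h3 + h4
  · classical
    let e : OffDiag n → OffDiag n → ASAlg n 0 := fun p => Pi.single p (offu p)
    have he : ∀ p, mulOffu n (Pi.single p 1) = e p := fun p => by
      ext r
      by_cases h : r = p
      · subst h; simp [mulOffu_apply, e]
      · simp [mulOffu_apply, e, h]
    have hs : ∀ p : OffDiag n, sumu n (Pi.single p 1) = offu p := fun p => by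
      simp_rw [sumu_apply, ← mulOffu_apply, he, e]
      simp
    have he' : ∀ p, offu p • e p = e p := fun p => by
      ext r
      by_cases h : r = p
      · subst h; simp [e, offu_mul_self]
      · simp [e, h]
    have h1 : ∀ p : OffDiag n,
        f (ASu 0 p.1.2 p.1.2 - ASu 0 p.1.1 p.1.1) (offu p) (offu p) =
          ∑ j, ((if p.1.2 = j then 1 else 0) - if p.1.1 = j then 1 else 0) *
            H (e p) (ASu 0 j j) := by
      intro p
      have h2 : (ASu 0 p.1.2 p.1.2 - ASu 0 p.1.1 p.1.1) * offu p = 0 := by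
        rw [sub_mul, snd_mul_offu, fst_mul_offu, sub_zero]
      have h3 := f_sumu (ASu 0 p.1.2 p.1.2 - ASu 0 p.1.1 p.1.1) (offu p) (Pi.single p 1)
      rw [hs, L_apply, h2, map_smul (mulOffu n), he, he'] at h3
      rw [h3]
      simp [ASeps_u, sub_mul, Finset.sum_sub_distrib]
    have h4 : ∀ j : Fin n, ∑ p : OffDiag n,
        (((if p.1.2 = j then 1 else 0) - if p.1.1 = j then 1 else 0) : ℂ) • e p =
          diffu n (Pi.single j 1) := by
      intro j
      ext r
      rw [Finset.sum_apply, Finset.sum_eq_single r]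
      · simp only [e, Pi.smul_apply, Pi.single_eq_same, diffu_apply, Pi.single_apply, sub_mul]
        refine (sub_smul (_ : ℂ) _ (offu r)).trans ?_
        simp
      · intro p _ hp; simp [e, hp.symm]
      · simp
    have h5 : ∀ j, H (diffu n (Pi.single j 1)) (ASu 0 j j) = k (Pi.single j 1) := fun j => by
      rw [hH, K_apply, ASeps_u, if_pos rfl, one_mul, sub_eq_self, ← hk_diag (Pi.single j 1)]
      congr 1
      ext r
      by_cases h : r = j
      · subst h; simp
      · simp [h]
    have h6 : ∑ j, (Pi.single j 1 : Fin n → ASAlg n 0) = fun _ => 1 :=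
      Finset.univ_sum_single _
    have h7 := hk 1 0
    rw [charge, Finset.sum_congr rfl fun p _ => h1 p, Finset.sum_comm]
    have h8 : ∀ j : Fin n, ∑ p : OffDiag n,
        ((if p.1.2 = j then 1 else 0) - if p.1.1 = j then 1 else 0) * H (e p) (ASu 0 j j) =
          k (Pi.single j 1) := fun j => by
      rw [← h5, ← h4, map_sum, LinearMap.sum_apply]
      simp
    rw [Finset.sum_congr rfl fun j _ => h8 j, ← map_sum, h6]
    simpa using h7

end ASAlg

/-- For `n ≥ 4`, the third Hochschild cohomology of `A_s(n)` (realized as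
`A_s(n,d)` with `d = 0`) with trivial coefficients is one-dimensional: there is a 3-cocycle
`f₀` which is not a coboundary and such that every 3-cocycle is, modulo coboundaries, a
scalar multiple of `f₀`; that is, `H³(A_s(n), ℂ) ≅ ℂ`. -/
theorem third_cohomology_one_dimensional (n : ℕ) (hn : 4 ≤ n) :
    ∃ f₀ : MultilinearMap ℂ (fun _ : Fin 3 => ASAlg n 0) ℂ,
      (∀ a, hdiff (ASeps n 0) 3 ⇑f₀ a = 0)
      ∧ (¬ ∃ g : MultilinearMap ℂ (fun _ : Fin 2 => ASAlg n 0) ℂ,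
            ∀ a, f₀ a = hdiff (ASeps n 0) 2 ⇑g a)
      ∧ ∀ f : MultilinearMap ℂ (fun _ : Fin 3 => ASAlg n 0) ℂ,
          (∀ a, hdiff (ASeps n 0) 3 ⇑f a = 0) →
          ∃ (s : ℂ) (g : MultilinearMap ℂ (fun _ : Fin 2 => ASAlg n 0) ℂ),
            ∀ a, f a = s * f₀ a + hdiff (ASeps n 0) 2 ⇑g a := by
  obtain ⟨f₀, hf₀, h1⟩ := ASAlg.exists_trilinDiff_eq_zero hn
  refine ⟨uncurry₃ _ f₀, fun a => ?_, ?_, fun f hf => ?_⟩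
  · rw [hdiff_uncurry₃, hf₀]
  · rintro ⟨g, hg⟩
    obtain ⟨g, rfl⟩ := (uncurry₂ (ASAlg n 0)).surjective g
    refine one_ne_zero (h1.symm.trans (ASAlg.charge_eq_zero g fun a b c => ?_))
    have := hg ![a, b, c]
    rwa [hdiff_uncurry₂] at this
  · obtain ⟨f, rfl⟩ := (uncurry₃ (ASAlg n 0)).surjective f
    have hf' : ∀ a b c d, trilinDiff (ASeps n 0) f a b c d = 0 := fun a b c d => by
      have := hf ![a, b, c, d]
      rwa [hdiff_uncurry₃] at this
    obtain ⟨g, hg⟩ := ASAlg.exists_bilinDiff_eq hn (f := f - ASAlg.charge f • f₀)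
      (fun a b c d => by rw [trilinDiff_sub_smul, hf', hf₀, mul_zero, sub_zero])
      (by rw [ASAlg.charge_sub_smul, h1, mul_one, sub_self])
    refine ⟨ASAlg.charge f, uncurry₂ _ g, fun a => ?_⟩
    rw [hdiff_uncurry₂, ← hg, uncurry₃_apply, uncurry₃_apply]
    simp
end
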